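/- arXiv:math/0210131 — 4 statements merged into one kernel-verified Lean document; each statement's English description precedes it below -/
import Mathlib

section
/- Let (R,m) ↪ (S,n) be a pure, module-finite local homomorphism of F-finite normal local rings of prime characteristic p > 0 which is étale in codimension one. Let a be a nonzero ideal of R and t ≥ 0 a rational number, and assume that condition (*) is satisfied for a^t over R and for (aS)^t over S. Then τ((aS)^t) ∩ R = τ(a^t). -/
open scoped TensorProduct

universe u

variable (R : Type u) [CommRing R]

/-- `R°`: the set of elements of `R` not contained in any minimal prime ideal. -/
def Rcirc : Set R := {c : R | ∀ P ∈ minimalPrimes R, c ∉ P}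

/-- The Frobenius power `I^{[q]}`: the ideal generated by the `q`-th powers of elements of `I`. -/
def frobPow (I : Ideal R) (q : ℕ) : Ideal R := Ideal.span ((fun x : R => x ^ q) '' (I : Set R))

/-- The `a^t`-tight closure of an ideal `J`. -/
def tightClosure (p : ℕ) (a : Ideal R) (t : ℚ) (J : Ideal R) : Set R :=
  {z : R | ∃ c ∈ Rcirc R, ∃ e₀ : ℕ, ∀ e : ℕ, e₀ ≤ e →
    ∀ x ∈ a ^ ⌈t * (p : ℚ) ^ e⌉₊, c * z ^ p ^ e * x ∈ frobPow R J (p ^ e)}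

/-- The generalized test ideal `τ(a^t) = ⋂_J (J : J^{*aᵗ})`. -/
def testIdeal (p : ℕ) (a : Ideal R) (t : ℚ) : Ideal R :=
  ⨅ J : Ideal R, Submodule.colon J (Ideal.span (tightClosure R p a t J))

/-- `R` is F-finite: finitely generated over itself via the Frobenius endomorphism. -/
def FrobAlg (p e : ℕ) : Type u := R

instance : CommRing (FrobAlg R p e) := inferInstanceAs (CommRing R)

/-- The identity of `R`, viewed as a ring map `R →+* ᵉR`. -/
def FrobAlg.of (p e : ℕ) : R →+* FrobAlg R p e := RingHom.id R

noncomputable instance [ExpChar R p] : Algebra R (FrobAlg R p e) :=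
  ((FrobAlg.of R p e).comp (iterateFrobenius R p e)).toAlgebra

/-- F-finiteness of `R`. -/
def IsFFinite (p : ℕ) [ExpChar R p] : Prop := Module.Finite R (FrobAlg R p 1)

/-- `0^{*aᵗ}_M`, the `aᵗ`-tight closure of zero in a module `M`. -/
def moduleTC (p : ℕ) [ExpChar R p] (a : Ideal R) (t : ℚ)
    (M : Type u) [AddCommGroup M] [Module R M] : Set M :=
  {z : M | ∃ c ∈ Rcirc R, ∃ e₀ : ℕ, ∀ e : ℕ, e₀ ≤ e →
    ∀ x ∈ a ^ ⌈t * (p : ℚ) ^ e⌉₊,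
      (FrobAlg.of R p e (c * x)) ⊗ₜ[R] z = (0 : TensorProduct R (FrobAlg R p e) M)}

/-- `τ̃(aᵗ) = Ann_R (0^{*aᵗ}_E)`. -/
def tildeTau (p : ℕ) [ExpChar R p] (a : Ideal R) (t : ℚ)
    (E : Type u) [AddCommGroup E] [Module R E] : Ideal R :=
  (Submodule.span R (moduleTC R p a t E)).annihilator

/-- `E` is an injective hull of the `R`-module `M`. -/
def IsInjectiveHull (M : Type u) [AddCommGroup M] [Module R M]
    (E : Type u) [AddCommGroup E] [Module R E] : Prop :=
  Module.Injective R E ∧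
    ∃ ι : M →ₗ[R] E, Function.Injective ι ∧
      ∀ N : Submodule R E, N ≠ ⊥ → N ⊓ LinearMap.range ι ≠ ⊥

/-- `d` is an `aᵗ`-test element. -/
def IsTestElement (p : ℕ) [ExpChar R p] (a : Ideal R) (t : ℚ) (d : R) : Prop :=
  d ∈ Rcirc R ∧
    ∀ (M : Type u) [AddCommGroup M] [Module R M], Module.Finite R M →
      ∀ z : M, z ∈ moduleTC R p a t M ↔
        ∀ e : ℕ, ∀ x ∈ a ^ ⌈t * (p : ℚ) ^ e⌉₊,
          (FrobAlg.of R p e (d * x)) ⊗ₜ[R] z = (0 : TensorProduct R (FrobAlg R p e) M)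

set_option linter.unusedSectionVars false

theorem aux_normal_dvd {S : Type*} [CommRing S] [IsDomain S] [IsIntegrallyClosed S]
    [IsNoetherianRing S] (x y : S) (hy : y ≠ 0)
    (h : ∀ (Q : Ideal S) [Q.IsPrime], ringKrullDim (Localization.AtPrime Q) ≤ 1 →
      ∃ f, f ∉ Q ∧ y ∣ f * x) : y ∣ x := by
  by_contra hxy
  have hx0 : (Ideal.Quotient.mk (Ideal.span {y}) x : S ⧸ Ideal.span {y}) ≠ 0 := by
    rw [Ne, Ideal.Quotient.eq_zero_iff_mem, Ideal.mem_span_singleton]; exact hxy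
  obtain ⟨Q, hQa, hle⟩ := exists_le_isAssociatedPrime_of_isNoetherianRing S _ hx0
  have hQ : Q.IsPrime := hQa.isPrime
  obtain ⟨_, b', hb'⟩ := isAssociatedPrime_iff.mp hQa
  obtain ⟨b, rfl⟩ := Ideal.Quotient.mk_surjective b'
  have key : ∀ (u v : S), v ∈ (⊥ : Submodule S (S ⧸ Ideal.span {y})).colon
      {Ideal.Quotient.mk (Ideal.span {y}) u} ↔ y ∣ v * u := by
    intro u v
    rw [Submodule.mem_colon_singleton, Submodule.mem_bot, ← Ideal.mem_span_singleton,
      ← Ideal.Quotient.eq_zero_iff_mem, map_mul]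
    rfl
  have hQm : ∀ v, v ∈ Q ↔ y ∣ v * b := by intro v; rw [hb', key]
  have hyQ : y ∈ Q := (hQm y).2 (dvd_mul_right _ _)
  have hbn : ¬ y ∣ b := by
    intro hd
    apply hQ.ne_top
    rw [Ideal.eq_top_iff_one, hQm]; simpa using hd
  let K := FractionRing S
  have hy' : algebraMap S K y ≠ 0 := by simpa using hy
  have hex : ∃ w ∈ Q, ∃ v, v ∉ Q ∧ b * w = v * y := by
    by_contra! hcon
    let l : K := algebraMap S K b / algebraMap S K y
    let M := Submodule.map (Algebra.linearMap S K) Q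
    have hl : IsIntegral S l := by
      refine isIntegral_of_smul_mem_submodule M ?_ ?_ l ?_
      · rw [Submodule.ne_bot_iff]; exact ⟨_, ⟨y, hyQ, rfl⟩, hy'⟩
      · apply Submodule.FG.map; exact IsNoetherian.noetherian _
      · rintro _ ⟨m, hm, rfl⟩
        obtain ⟨k, hk⟩ := (hQm m).1 hm
        have hkQ : k ∈ Q := by
          by_contra hkQ
          exact hcon m hm k hkQ (by rw [mul_comm, hk, mul_comm])
        refine ⟨k, hkQ, ?_⟩
        simp only [Algebra.linearMap_apply, smul_eq_mul, l]
        rw [div_mul_eq_mul_div, eq_div_iff hy', ← map_mul, ← map_mul, mul_comm b, hk, mul_comm]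
    obtain ⟨z, e⟩ := IsIntegrallyClosed.algebraMap_eq_of_integral hl
    apply hbn
    refine ⟨z, IsFractionRing.injective S K ?_⟩
    rw [map_mul, e, mul_div_cancel₀ _ hy']
  obtain ⟨w, hwQ, v, hvQ, hvw⟩ := hex
  have hmin : Q ∈ (Ideal.span {w}).minimalPrimes := by
    refine ⟨⟨hQ, by simpa using hwQ⟩, ?_⟩
    rintro P ⟨hP, hwP⟩ hPQ q hq
    have hwP : w ∈ P := by simpa using hwP
    obtain ⟨s, hs⟩ := (hQm q).1 hq
    have : v * q = s * w := by
      apply mul_left_cancel₀ hy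
      calc y * (v * q) = (v * y) * q := by ring
        _ = (q * b) * w := by rw [← hvw]; ring
        _ = _ := by rw [hs]; ring
    have h2 : v * q ∈ P := this ▸ P.mul_mem_left _ hwP
    exact (hP.mem_or_mem h2).resolve_left (fun h => hvQ (hPQ h))
  have hht := Ideal.height_le_one_of_isPrincipal_of_mem_minimalPrimes (Ideal.span {w}) Q hmin
  obtain ⟨f, hf, hd⟩ := h Q (by
    rw [IsLocalization.AtPrime.ringKrullDim_eq_height Q]; exact_mod_cast hht)
  exact hf (hle ((key x f).2 hd))

theorem aux_theta {R S : Type*} [CommRing R] [CommRing S] [Algebra R S] [Module.Finite R S]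
    (Q : Ideal S) [Q.IsPrime] (h : Algebra.FormallyUnramified R (Localization.AtPrime Q)) :
    ∃ θ : S ⊗[R] S, Algebra.TensorProduct.lmul' R θ ∉ Q ∧
      ∀ s : S, (s ⊗ₜ[R] (1 : S)) * θ = ((1 : S) ⊗ₜ[R] s) * θ := by
  have hf : ∃ f ∉ Q, ∀ w : Ω[S⁄R], f • w = 0 := by
    have h1 : (⟨Q, inferInstance⟩ : PrimeSpectrum S) ∈ Algebra.unramifiedLocus R S := h
    rw [Algebra.unramifiedLocus_eq_compl_support, Set.mem_compl_iff,
      Module.mem_support_iff_of_finite, SetLike.not_le_iff_exists] at h1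
    obtain ⟨f, hf, hfQ⟩ := h1
    exact ⟨f, hfQ, fun w => Module.mem_annihilator.1 hf w⟩
  obtain ⟨f, hfQ, hf⟩ := hf
  let I := KaehlerDifferential.ideal R S
  have hIfg : I.FG := KaehlerDifferential.ideal_fg R S
  have : Module.Finite (S ⊗[R] S) I := Module.Finite.iff_fg.2 hIfg
  let F : S ⊗[R] S := f ⊗ₜ 1
  let φ : Module.End (S ⊗[R] S) I := LinearMap.lsmul (S ⊗[R] S) I F
  have hrange : LinearMap.range φ ≤ I • (⊤ : Submodule (S ⊗[R] S) I) := by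
    rintro _ ⟨x, rfl⟩
    have h2 : I.toCotangent (F • x) = 0 := by
      rw [map_smul]
      have := hf (I.toCotangent x)
      refine Eq.trans ?_ this
      exact (algebraMap_smul (S ⊗[R] S) f (I.toCotangent x : Ω[S⁄R]))
    rw [Ideal.toCotangent_eq_zero, pow_two] at h2
    have h3 : (I • (⊤ : Submodule (S ⊗[R] S) I)).map I.subtype = I * I := by
      rw [Submodule.map_smul'', Submodule.map_top, Submodule.range_subtype]; rfl
    rw [← h3] at h2
    obtain ⟨y, hy, hyx⟩ := h2
    have : y = F • x := Subtype.ext hyx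
    rw [this] at hy
    exact hy
  obtain ⟨P, hmon, hdeg, hco, hP⟩ :=
    LinearMap.exists_monic_and_natDegree_eq_and_coeff_mem_pow_and_aeval_eq_zero _ φ I hrange
  refine ⟨P.eval F, ?_, ?_⟩
  · have h3 : Algebra.TensorProduct.lmul' R (P.eval F) = f ^ P.natDegree := by
      let μ : S ⊗[R] S →+* S := (Algebra.TensorProduct.lmul' R : S ⊗[R] S →ₐ[R] S).toRingHom
      have hF : μ F = f := by simp [μ, F]
      have hI : ∀ x ∈ I, μ x = 0 := fun x hx => hx
      change μ (P.eval F) = _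
      rw [Polynomial.eval_eq_sum_range, Finset.sum_range_succ, hmon.coeff_natDegree, map_add, map_sum,
        Finset.sum_eq_zero, one_mul, zero_add, map_pow, hF]
      intro k hk
      have : P.coeff k ∈ I :=
        Ideal.pow_le_self (by have := Finset.mem_range.1 hk; omega) (hco k)
      rw [map_mul, hI _ this, zero_mul]
    rw [h3]
    exact fun h => hfQ (Ideal.IsPrime.mem_of_pow_mem inferInstance _ h)
  · intro s
    let i : I := ⟨_, KaehlerDifferential.one_smul_sub_smul_one_mem_ideal R s⟩
    have h4 : (Polynomial.aeval φ P) i = (P.eval F) • i := by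
      have : φ = algebraMap _ _ F := rfl
      rw [this, Polynomial.aeval_algebraMap_apply, Polynomial.coe_aeval_eq_eval]
      rfl
    rw [hP, LinearMap.zero_apply] at h4
    have h5 : P.eval F * ((1 : S) ⊗ₜ[R] s - s ⊗ₜ[R] (1 : S)) = 0 := congrArg Subtype.val h4.symm
    rw [mul_sub, sub_eq_zero] at h5
    rw [mul_comm, ← h5, mul_comm]

/-- trace identity over a field -/
theorem aux_trace_field {K L : Type*} [Field K] [Field L] [Algebra K L] [FiniteDimensional K L]
    (θ : L ⊗[K] L) (h : ∀ s : L, (s ⊗ₜ[K] (1 : L)) * θ = ((1 : L) ⊗ₜ[K] s) * θ) :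
    (TensorProduct.rid K L) ((Algebra.trace K L).lTensor L θ) =
      Algebra.TensorProduct.lmul' K θ := by
  classical
  let b := Module.finBasis K L
  have h1 : ∀ θ : L ⊗[K] L, (TensorProduct.rid K L) ((Algebra.trace K L).lTensor L θ) =
      ∑ j, (TensorProduct.rid K L) ((b.coord j).lTensor L (((1 : L) ⊗ₜ[K] b j) * θ)) := by
    intro θ
    induction θ with
    | zero => simp
    | add x y hx hy => simp only [map_add, mul_add, hx, hy, Finset.sum_add_distrib]
    | tmul x y =>
      simp only [LinearMap.lTensor_tmul, TensorProduct.rid_tmul,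
        Algebra.TensorProduct.tmul_mul_tmul, one_mul]
      rw [← Finset.sum_smul, Algebra.trace_eq_matrix_trace b, Matrix.trace]
      simp only [Matrix.diag, Algebra.leftMulMatrix_eq_repr_mul, Module.Basis.coord_apply, mul_comm]
  have h2 : ∀ θ : L ⊗[K] L, Algebra.TensorProduct.lmul' K θ =
      ∑ j, (TensorProduct.rid K L) ((b.coord j).lTensor L ((b j ⊗ₜ[K] (1 : L)) * θ)) := by
    intro θ
    induction θ with
    | zero => simp
    | add x y hx hy => simp only [map_add, mul_add, hx, hy, Finset.sum_add_distrib]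
    | tmul x y =>
      simp only [LinearMap.lTensor_tmul, TensorProduct.rid_tmul,
        Algebra.TensorProduct.tmul_mul_tmul, one_mul, Algebra.TensorProduct.lmul'_apply_tmul]
      conv_lhs => rw [← b.sum_repr y, Finset.mul_sum]
      refine Finset.sum_congr rfl fun j _ => ?_
      simp [mul_comm]
  rw [h1, h2]
  simp only [h]

theorem aux_trace_frob_field {K L : Type*} [Field K] [Field L] [Algebra K L]
    [FiniteDimensional K L] (p : ℕ) [Fact p.Prime] [CharP K p] (e : ℕ) (x : L) :
    Algebra.trace K L (x ^ p ^ e) = (Algebra.trace K L x) ^ p ^ e := by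
  have hp : p.Prime := Fact.out
  by_cases H : Algebra.IsSeparable K L
  · let Ω := AlgebraicClosure K
    have : CharP Ω p := charP_of_injective_algebraMap (algebraMap K Ω).injective p
    apply (algebraMap K Ω).injective
    rw [map_pow (algebraMap K Ω), trace_eq_sum_embeddings Ω, trace_eq_sum_embeddings Ω, sum_pow_char_pow]
    simp
  · rw [Algebra.trace_eq_zero_of_not_isSeparable H]
    simp [hp.ne_zero]

section
variable {R S : Type*} [CommRing R] [CommRing S]
    [IsDomain R] [IsDomain S] [IsIntegrallyClosed R] [IsIntegrallyClosed S] [Algebra R S]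
    [Module.Finite R S] [Module.IsTorsionFree R S]

attribute [local instance] FractionRing.liftAlgebra FractionRing.isScalarTower_liftAlgebra

theorem aux_findim : FiniteDimensional (FractionRing R) (FractionRing S) := by
  have : IsIntegralClosure S R (FractionRing S) :=
    IsIntegralClosure.of_isIntegrallyClosed _ _ _
  have : Algebra.IsAlgebraic (FractionRing R) (FractionRing S) :=
    isAlgebraic_of_isFractionRing R S ..
  have : IsLocalization (Algebra.algebraMapSubmonoid S (nonZeroDivisors R)) (FractionRing S) :=
    IsIntegralClosure.isLocalization _ (FractionRing R) _ _
  exact .of_isLocalization R S (nonZeroDivisors R)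

theorem aux_intTrace_frob (p : ℕ) [Fact p.Prime] [CharP R p] (e : ℕ) (x : S) :
    Algebra.intTrace R S (x ^ p ^ e) = (Algebra.intTrace R S x) ^ p ^ e := by
  have := aux_findim (R := R) (S := S)
  have : CharP (FractionRing R) p :=
    charP_of_injective_algebraMap (IsFractionRing.injective R (FractionRing R)) p
  apply IsFractionRing.injective R (FractionRing R)
  rw [map_pow (algebraMap R (FractionRing R)), Algebra.algebraMap_intTrace_fractionRing, Algebra.algebraMap_intTrace_fractionRing,
    map_pow, aux_trace_frob_field p]

theorem aux_intTrace_theta' (K L : Type*) [Field K] [Field L] [Algebra R K] [IsFractionRing R K]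
    [Algebra K L] [Algebra R L] [IsScalarTower R K L] [Algebra S L] [IsScalarTower R S L]
    [IsIntegralClosure S R L] [FiniteDimensional K L] [IsFractionRing S L]
    (θ : S ⊗[R] S) (h : ∀ s : S, (s ⊗ₜ[R] (1 : S)) * θ = ((1 : S) ⊗ₜ[R] s) * θ) :
    (TensorProduct.rid R S) ((Algebra.intTrace R S).lTensor S θ) =
      Algebra.TensorProduct.lmul' R θ := by
  let g : S ⊗[R] S →ₐ[R] L ⊗[K] L := Algebra.TensorProduct.lift
    ((Algebra.TensorProduct.includeLeft (R := K) (S := R) (A := L) (B := L)).comp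
        (IsScalarTower.toAlgHom R S L))
    (((Algebra.TensorProduct.includeRight (R := K) (A := L) (B := L)).restrictScalars R).comp
        (IsScalarTower.toAlgHom R S L)) (fun _ _ => Commute.all _ _)
  have hg : ∀ x y, g (x ⊗ₜ y) = algebraMap S L x ⊗ₜ[K] algebraMap S L y := by
    intro x y; simp [g]
  have hS : ∀ s : S, (algebraMap S L s ⊗ₜ[K] (1 : L)) * g θ =
      ((1 : L) ⊗ₜ[K] algebraMap S L s) * g θ := by
    intro s
    have := congrArg g (h s)
    rwa [map_mul, map_mul, hg, hg, map_one] at this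
  have hL : ∀ s : L, (s ⊗ₜ[K] (1 : L)) * g θ = ((1 : L) ⊗ₜ[K] s) * g θ := by
    intro l
    have : IsLocalization (Algebra.algebraMapSubmonoid S (nonZeroDivisors R)) L :=
      IsIntegralClosure.isLocalization _ K _ _
    obtain ⟨⟨s, ⟨_, r, hr, rfl⟩⟩, e⟩ :=
      IsLocalization.surj (Algebra.algebraMapSubmonoid S (nonZeroDivisors R)) l
    have hrK : algebraMap R K r ≠ 0 := by simpa using nonZeroDivisors.ne_zero hr
    have hl : l = (algebraMap R K r)⁻¹ • algebraMap S L s := by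
      rw [eq_inv_smul_iff₀ hrK, ← e, Algebra.smul_def, ← IsScalarTower.algebraMap_apply R K L,
        ← IsScalarTower.algebraMap_apply R S L, mul_comm]
    rw [hl, TensorProduct.tmul_smul, ← TensorProduct.smul_tmul', smul_mul_assoc, smul_mul_assoc, hS]
  have key := aux_trace_field (g θ) hL
  apply IsFractionRing.injective S L
  have e1 : ∀ θ : S ⊗[R] S, algebraMap S L (Algebra.TensorProduct.lmul' R θ) =
      Algebra.TensorProduct.lmul' K (g θ) := by
    intro θ
    induction θ with
    | zero => simp
    | add x y hx hy => simp only [map_add, hx, hy]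
    | tmul x y => simp [hg]
  have e2 : ∀ θ : S ⊗[R] S, algebraMap S L
      ((TensorProduct.rid R S) ((Algebra.intTrace R S).lTensor S θ)) =
      (TensorProduct.rid K L) ((Algebra.trace K L).lTensor L (g θ)) := by
    intro θ
    induction θ with
    | zero => simp
    | add x y hx hy => simp only [map_add, hx, hy]
    | tmul x y =>
      simp only [LinearMap.lTensor_tmul, TensorProduct.rid_tmul, hg]
      rw [← Algebra.algebraMap_intTrace (A := R), Algebra.smul_def, Algebra.smul_def, map_mul,
        ← IsScalarTower.algebraMap_apply R K L, ← IsScalarTower.algebraMap_apply R S L]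
  rw [e1, e2, key]

theorem aux_intTrace_theta
    (θ : S ⊗[R] S) (h : ∀ s : S, (s ⊗ₜ[R] (1 : S)) * θ = ((1 : S) ⊗ₜ[R] s) * θ) :
    (TensorProduct.rid R S) ((Algebra.intTrace R S).lTensor S θ) =
      Algebra.TensorProduct.lmul' R θ := by
  have := aux_findim (R := R) (S := S)
  have : IsIntegralClosure S R (FractionRing S) :=
    IsIntegralClosure.of_isIntegrallyClosed _ _ _
  exact aux_intTrace_theta' (FractionRing R) (FractionRing S) θ h
end

section
variable {R : Type u} [CommRing R] [IsNoetherianRing R] {S : Type u} [AddCommGroup S] [Module R S]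
  [Module.Finite R S] {E : Type u} [AddCommGroup E] [Module R E]

theorem aux_dual_surj (hE : Module.Injective R E) (h : (S →ₗ[R] R) →ₗ[R] E) :
    ∃ ζ : S ⊗[R] E, ∀ φ : S →ₗ[R] R, TensorProduct.lid R E (φ.rTensor E ζ) = h φ := by
  classical
  obtain ⟨n, s, hs⟩ := Module.Finite.exists_fin (R := R) (M := S)
  let ι : (S →ₗ[R] R) →ₗ[R] (Fin n → R) :=
    { toFun := fun φ i => φ (s i)
      map_add' := fun _ _ => rfl
      map_smul' := fun _ _ => rfl }
  have hι : Function.Injective ι := by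
    intro φ ψ hφ
    refine LinearMap.ext_on_range hs fun i => congrFun hφ i
  obtain ⟨H, hH⟩ := hE.out ι hι h
  refine ⟨∑ i, s i ⊗ₜ H (Pi.single i 1), fun φ => ?_⟩
  rw [← hH, map_sum, map_sum]
  conv_rhs => rw [pi_eq_sum_univ' (ι φ), map_sum]
  refine Finset.sum_congr rfl fun i _ => ?_
  rw [map_smul]
  simp only [LinearMap.rTensor_tmul, TensorProduct.lid_tmul, ι, LinearMap.coe_mk, AddHom.coe_mk]

theorem aux_dual_inj (hE : Module.Injective R E) (ζ : S ⊗[R] E)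
    (h : ∀ φ : S →ₗ[R] R, TensorProduct.lid R E (φ.rTensor E ζ) = 0) : ζ = 0 := by
  classical
  obtain ⟨n, s, hs⟩ := Module.Finite.exists_fin (R := R) (M := S)
  let f : (Fin n → R) →ₗ[R] S := Fintype.linearCombination R s
  have hfs : ∀ v, f v = ∑ i, v i • s i := fun v => Fintype.linearCombination_apply R s v
  have hf : Function.Surjective f := by
    rw [← LinearMap.range_eq_top, Fintype.range_linearCombination, hs]
  have hζ : ∃ y : Fin n → E, ζ = ∑ i, s i ⊗ₜ y i := by
    clear h
    induction ζ with
    | zero => exact ⟨0, by simp⟩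
    | add a b ha hb =>
      obtain ⟨y, rfl⟩ := ha
      obtain ⟨y', rfl⟩ := hb
      exact ⟨y + y', by simp [TensorProduct.tmul_add, Finset.sum_add_distrib]⟩
    | tmul a e =>
      obtain ⟨v, rfl⟩ := hf a
      refine ⟨fun i => v i • e, ?_⟩
      rw [hfs, TensorProduct.sum_tmul]
      simp [TensorProduct.smul_tmul]
  obtain ⟨y, rfl⟩ := hζ
  obtain ⟨m, g, hg⟩ := Submodule.fg_iff_exists_fin_generating_family.1
    (IsNoetherian.noetherian (LinearMap.ker f))
  let A : (Fin n → R) →ₗ[R] (Fin m → R) :=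
    { toFun := fun w k => ∑ i, w i * g k i
      map_add' := fun _ _ => by ext; simp [add_mul, Finset.sum_add_distrib]
      map_smul' := fun _ _ => by ext; simp [Finset.mul_sum, mul_assoc] }
  let Y : (Fin n → R) →ₗ[R] E := Fintype.linearCombination R y
  have hY : ∀ v, Y v = ∑ i, v i • y i := fun v => Fintype.linearCombination_apply R y v
  have hker : LinearMap.ker A ≤ LinearMap.ker Y := by
    intro w hw
    let W : (Fin n → R) →ₗ[R] R := Fintype.linearCombination R w
    have hW : ∀ v, W v = ∑ i, v i • w i := fun v => Fintype.linearCombination_apply R w v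
    have hWk : LinearMap.ker f ≤ LinearMap.ker W := by
      rw [← hg, Submodule.span_le]
      rintro _ ⟨k, rfl⟩
      have := congrFun (LinearMap.mem_ker.1 hw) k
      change W _ = 0
      rw [hW]
      refine Eq.trans ?_ this
      exact Finset.sum_congr rfl fun i _ => by simp [mul_comm]
    let φ : S →ₗ[R] R := (LinearMap.ker f).liftQ W hWk ∘ₗ
      (f.quotKerEquivOfSurjective hf).symm.toLinearMap
    have hφ : ∀ v, φ (f v) = W v := by
      intro v
      have : (f.quotKerEquivOfSurjective hf).symm (f v) = Submodule.Quotient.mk v := by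
        rw [LinearEquiv.symm_apply_eq]; rfl
      simp only [φ, LinearMap.comp_apply, LinearEquiv.coe_coe, this]
      rfl
    have h1 := h φ
    have hsi : ∀ i, s i = f (Pi.single i 1) := by
      intro i; rw [hfs]; simp [Pi.single_apply]
    rw [LinearMap.mem_ker, hY, ← h1, map_sum, map_sum]
    refine Finset.sum_congr rfl fun i _ => ?_
    rw [LinearMap.rTensor_tmul, TensorProduct.lid_tmul, hsi, hφ, hW]
    simp [Pi.single_apply]
  obtain ⟨H, hH⟩ := hE.out ((LinearMap.ker A).liftQ A le_rfl)
    (LinearMap.ker_eq_bot.1 (Submodule.ker_liftQ_eq_bot _ _ _ le_rfl))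
    ((LinearMap.ker A).liftQ Y hker)
  have hH' : ∀ w, H (A w) = Y w := fun w => hH (Submodule.Quotient.mk w)
  have hy : ∀ i, y i = ∑ k, g k i • H (Pi.single k 1) := by
    intro i
    have h2 : y i = Y (Pi.single i 1) := by rw [hY]; simp [Pi.single_apply]
    rw [h2, ← hH']
    conv_lhs => rw [pi_eq_sum_univ' (A _), map_sum]
    refine Finset.sum_congr rfl fun k _ => ?_
    rw [map_smul]
    congr 1
    simp [A, Pi.single_apply]
  have hk : ∀ k, ∑ i, g k i • s i = 0 := by
    intro k
    rw [← hfs]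
    have : g k ∈ LinearMap.ker f := hg ▸ Submodule.subset_span ⟨k, rfl⟩
    exact this
  calc ∑ i, s i ⊗ₜ[R] y i = ∑ i, ∑ k, (g k i • s i) ⊗ₜ[R] H (Pi.single k 1) := by
        refine Finset.sum_congr rfl fun i _ => ?_
        rw [hy, TensorProduct.tmul_sum]
        simp [TensorProduct.smul_tmul]
    _ = ∑ k, (∑ i, g k i • s i) ⊗ₜ[R] H (Pi.single k 1) := by
        rw [Finset.sum_comm]
        simp [TensorProduct.sum_tmul]
    _ = 0 := by simp [hk]
end

section
variable {R S : Type*} [CommRing R] [CommRing S]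
    [IsDomain R] [IsDomain S] [IsIntegrallyClosed R] [IsIntegrallyClosed S] [Algebra R S]
    [Module.Finite R S] [Module.IsTorsionFree R S]
/-- nondegeneracy of the trace -/
theorem aux_trace_nondeg
    (θ : S ⊗[R] S) (h : ∀ s : S, (s ⊗ₜ[R] (1 : S)) * θ = ((1 : S) ⊗ₜ[R] s) * θ)
    (h0 : Algebra.TensorProduct.lmul' R θ ≠ 0) (x : S)
    (hx : ∀ s, Algebra.intTrace R S (x * s) = 0) : x = 0 := by
  have e1 : ∀ θ : S ⊗[R] S, (TensorProduct.rid R S)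
      ((Algebra.intTrace R S).lTensor S (((1 : S) ⊗ₜ[R] x) * θ)) = 0 := by
    intro θ
    induction θ with
    | zero => simp
    | add a b ha hb => simp only [mul_add, map_add, ha, hb, add_zero]
    | tmul a b => simp [hx]
  have e2 : ∀ θ : S ⊗[R] S, (TensorProduct.rid R S)
      ((Algebra.intTrace R S).lTensor S ((x ⊗ₜ[R] (1 : S)) * θ)) =
      x * (TensorProduct.rid R S) ((Algebra.intTrace R S).lTensor S θ) := by
    intro θ
    induction θ with
    | zero => simp
    | add a b ha hb => simp only [mul_add, map_add, ha, hb]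
    | tmul a b => simp
  have := e2 θ
  rw [h, e1, aux_intTrace_theta θ h] at this
  exact (mul_eq_zero.1 this.symm).resolve_right h0

theorem aux_trace_rep
    (θ : S ⊗[R] S) (h : ∀ s : S, (s ⊗ₜ[R] (1 : S)) * θ = ((1 : S) ⊗ₜ[R] s) * θ)
    (φ : S →ₗ[R] R) : ∃ s : S, ∀ x,
      φ (Algebra.TensorProduct.lmul' R θ * x) = Algebra.intTrace R S (s * x) := by
  refine ⟨TensorProduct.rid R S (φ.lTensor S θ), fun x => ?_⟩
  have e1 : ∀ θ : S ⊗[R] S, TensorProduct.rid R S (φ.lTensor S θ) * x =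
      TensorProduct.rid R S (φ.lTensor S ((x ⊗ₜ[R] (1 : S)) * θ)) := by
    intro θ
    induction θ with
    | zero => simp
    | add a b ha hb => simp only [mul_add, add_mul, map_add, ha, hb]
    | tmul a b => simp [mul_comm]
  have e2 : ∀ θ : S ⊗[R] S, Algebra.intTrace R S (TensorProduct.rid R S (φ.lTensor S θ)) =
      φ (TensorProduct.rid R S ((Algebra.intTrace R S).lTensor S
        (Algebra.TensorProduct.comm R S S θ))) := by
    intro θ
    induction θ with
    | zero => simp
    | add a b ha hb => simp only [map_add, ha, hb]
    | tmul a b => simp [mul_comm]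
  have e3 : ∀ θ : S ⊗[R] S, TensorProduct.rid R S ((Algebra.intTrace R S).lTensor S
      (Algebra.TensorProduct.comm R S S (((1 : S) ⊗ₜ[R] x) * θ))) =
      x * TensorProduct.rid R S ((Algebra.intTrace R S).lTensor S
        (Algebra.TensorProduct.comm R S S θ)) := by
    intro θ
    induction θ with
    | zero => simp
    | add a b ha hb => simp only [mul_add, map_add, ha, hb]
    | tmul a b => simp
  have e4 : ∀ θ : S ⊗[R] S, Algebra.TensorProduct.lmul' R (Algebra.TensorProduct.comm R S S θ) =
      Algebra.TensorProduct.lmul' R θ := by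
    intro θ
    induction θ with
    | zero => simp
    | add a b ha hb => simp only [map_add, ha, hb]
    | tmul a b => simp [mul_comm]
  have h' : ∀ s : S, (s ⊗ₜ[R] (1 : S)) * Algebra.TensorProduct.comm R S S θ =
      ((1 : S) ⊗ₜ[R] s) * Algebra.TensorProduct.comm R S S θ := by
    intro s
    have := congrArg (Algebra.TensorProduct.comm R S S) (h s)
    rw [map_mul, map_mul, Algebra.TensorProduct.comm_tmul, Algebra.TensorProduct.comm_tmul] at this
    exact this.symm
  rw [e1, h, e2, e3, aux_intTrace_theta _ h', e4, mul_comm]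

theorem aux_trace_surj [IsNoetherianRing S]
    (hθ : ∀ (Q : Ideal S) [Q.IsPrime], ringKrullDim (Localization.AtPrime Q) ≤ 1 →
      ∃ θ : S ⊗[R] S, Algebra.TensorProduct.lmul' R θ ∉ Q ∧
      ∀ s : S, (s ⊗ₜ[R] (1 : S)) * θ = ((1 : S) ⊗ₜ[R] s) * θ)
    (θ₀ : S ⊗[R] S) (h₀ : ∀ s : S, (s ⊗ₜ[R] (1 : S)) * θ₀ = ((1 : S) ⊗ₜ[R] s) * θ₀)
    (h₀' : Algebra.TensorProduct.lmul' R θ₀ ≠ 0)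
    (φ : S →ₗ[R] R) : ∃ s : S, ∀ x, φ x = Algebra.intTrace R S (s * x) := by
  obtain ⟨s₀, hs₀⟩ := aux_trace_rep θ₀ h₀ φ
  set f₀ := Algebra.TensorProduct.lmul' R θ₀ with hf₀
  have hdvd : f₀ ∣ s₀ := by
    refine aux_normal_dvd _ _ h₀' fun Q _ hQ => ?_
    obtain ⟨θ, hθQ, hθ⟩ := hθ Q hQ
    obtain ⟨s, hs⟩ := aux_trace_rep θ hθ φ
    refine ⟨_, hθQ, s, ?_⟩
    rw [← sub_eq_zero]
    refine aux_trace_nondeg θ₀ h₀ h₀' _ fun x => ?_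
    rw [sub_mul, map_sub, sub_eq_zero]
    rw [mul_comm _ s₀, mul_assoc, ← hs₀, mul_comm f₀ s, mul_assoc, ← hs]
    ring_nf
  obtain ⟨s, hs⟩ := hdvd
  refine ⟨s, fun x => ?_⟩
  obtain ⟨r, hr, c, hc⟩ :=
    (Algebra.IsIntegral.isIntegral (R := R) f₀).isAlgebraic.exists_nonzero_dvd
      (mem_nonZeroDivisors_of_ne_zero h₀')
  apply mul_left_cancel₀ hr
  have h1 := hs₀ (c * x)
  have h2 : f₀ * (c * x) = r • x := by rw [Algebra.smul_def, hc, mul_assoc]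
  have h3 : s₀ * (c * x) = r • (s * x) := by rw [Algebra.smul_def, hc, hs]; ring
  rw [h2, h3, map_smul, map_smul] at h1
  exact h1
end


section
variable {R : Type u} [CommRing R]

theorem aux_rcirc [IsDomain R] (c : R) : c ∈ Rcirc R ↔ c ≠ 0 := by
  simp [Rcirc, IsDomain.minimalPrimes_eq_singleton_bot]

theorem aux_easy {S : Type u} [CommRing S] [IsDomain R] [IsDomain S] [Algebra R S] (p : ℕ)
    (hinj : Function.Injective (algebraMap R S))
    (hpure : ∀ (M : Type u) [AddCommGroup M] [Module R M],
      Function.Injective (fun m : M => (m ⊗ₜ[R] (1 : S) : TensorProduct R M S)))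
    (a : Ideal R) (t : ℚ) :
    (testIdeal S p (a.map (algebraMap R S)) t).comap (algebraMap R S) ≤ testIdeal R p a t := by
  intro r hr
  rw [Ideal.mem_comap, testIdeal, Ideal.mem_iInf] at hr
  rw [testIdeal, Ideal.mem_iInf]
  intro J
  have hcontr : ∀ x : R, algebraMap R S x ∈ J.map (algebraMap R S) → x ∈ J := by
    intro x hx
    rw [← Ideal.Quotient.eq_zero_iff_mem]
    apply hpure (R ⧸ J)
    simp only [TensorProduct.zero_tmul]
    have h1 : (Ideal.Quotient.mk J x) ⊗ₜ[R] (1 : S) =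
        (1 : R ⧸ J) ⊗ₜ[R] (algebraMap R S x) := by
      rw [Algebra.algebraMap_eq_smul_one, ← TensorProduct.smul_tmul]
      congr 1
      rw [Algebra.smul_def, mul_one]; rfl
    rw [h1]
    have h2 : ∀ y ∈ J.map (algebraMap R S), (1 : R ⧸ J) ⊗ₜ[R] y = 0 := by
      intro y hy
      induction hy using Submodule.span_induction with
      | mem y hy =>
        obtain ⟨z, hz, rfl⟩ := hy
        rw [Algebra.algebraMap_eq_smul_one, ← TensorProduct.smul_tmul]
        have : z • (1 : R ⧸ J) = 0 := by
          rw [Algebra.smul_def, mul_one]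
          exact Ideal.Quotient.eq_zero_iff_mem.2 hz
        rw [this, TensorProduct.zero_tmul]
      | zero => simp
      | add u v _ _ hu hv => rw [TensorProduct.tmul_add, hu, hv, add_zero]
      | smul s u _ hu =>
        have := congrArg (fun w => ((1 : R ⧸ J) ⊗ₜ[R] s) * w) hu
        simpa using this
    exact h2 _ hx
  have hle : Ideal.span (tightClosure R p a t J) ≤
      (J.colon {r}) := by
    rw [Ideal.span_le]
    rintro z ⟨c, hc, e₀, h⟩
    rw [SetLike.mem_coe, Submodule.mem_colon_singleton]
    apply hcontr
    have hz : algebraMap R S z ∈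
        tightClosure S p (a.map (algebraMap R S)) t (J.map (algebraMap R S)) := by
      refine ⟨algebraMap R S c, ?_, e₀, ?_⟩
      · rw [aux_rcirc] at hc ⊢
        simpa [map_eq_zero_iff _ hinj] using hc
      · intro e he x hx
        rw [← Ideal.map_pow] at hx
        induction hx using Submodule.span_induction with
        | mem y hy =>
          obtain ⟨x, hx, rfl⟩ := hy
          have h3 := Ideal.mem_map_of_mem (algebraMap R S) (h e he x hx)
          rw [map_mul, map_mul, map_pow] at h3
          refine (?_ : (frobPow R J (p ^ e)).map (algebraMap R S) ≤ _) h3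
          rw [frobPow, Ideal.map_span, Ideal.span_le]
          rintro _ ⟨_, ⟨j, hj, rfl⟩, rfl⟩
          apply Ideal.subset_span
          exact ⟨algebraMap R S j, Ideal.mem_map_of_mem _ hj, by simp⟩
        | zero => simp
        | add u v _ _ hu hv => rw [mul_add]; exact Ideal.add_mem _ hu hv
        | smul s u _ hu =>
          rw [smul_eq_mul, mul_left_comm]; exact Ideal.mul_mem_left _ _ hu
    have := Submodule.mem_colon.1 (hr (J.map (algebraMap R S))) _ (Ideal.subset_span hz)
    rw [smul_eq_mul, mul_comm] at this
    simpa using this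
  rw [Submodule.mem_colon]
  intro z hz
  have := hle hz
  rw [Submodule.mem_colon_singleton] at this
  rw [smul_eq_mul, mul_comm]
  exact this

end

section
variable {R S : Type u} [CommRing R] [CommRing S]
    [IsDomain R] [IsDomain S] [IsIntegrallyClosed R] [IsIntegrallyClosed S] [Algebra R S]
    [Module.Finite R S] [Module.IsTorsionFree R S]

set_option linter.unusedSectionVars false

theorem aux_frobAlg_smul (p : ℕ) [ExpChar R p] (e : ℕ) (r : R) (x : FrobAlg R p e) :
    r • x = FrobAlg.of R p e (r ^ p ^ e) * x := by
  rw [Algebra.smul_def]; rfl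

theorem aux_frob_trace (p : ℕ) [Fact p.Prime] [CharP R p] [CharP S p] [ExpChar R p] [ExpChar S p]
    {E : Type u} [AddCommGroup E] [Module R E] (e : ℕ) (c : R) (ζ : S ⊗[R] E)
    (h : (FrobAlg.of S p e (algebraMap R S c)) ⊗ₜ[S] ζ =
      (0 : TensorProduct S (FrobAlg S p e) (S ⊗[R] E))) :
    (FrobAlg.of R p e c) ⊗ₜ[R] (TensorProduct.lid R E ((Algebra.intTrace R S).rTensor E ζ)) =
      (0 : TensorProduct R (FrobAlg R p e) E) := by
  let T : S →ₗ[R] R := Algebra.intTrace R S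
  let T' : FrobAlg S p e →+ FrobAlg R p e := T.toAddMonoidHom
  let q := p ^ e
  let fr : S →+* FrobAlg S p e := (FrobAlg.of S p e).comp (iterateFrobenius S p e)
  have hfr : ∀ s, fr s = FrobAlg.of S p e (s ^ p ^ e) := fun s => rfl
  have hT' : ∀ r (u : FrobAlg S p e), T' (FrobAlg.of S p e (algebraMap R S r) * u) =
      FrobAlg.of R p e r * T' u := by
    intro r u
    have h0 : ∀ v : S, T (algebraMap R S r * v) = r * T v := by
      intro v
      rw [← Algebra.smul_def, map_smul, smul_eq_mul]
    exact h0 u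
  -- the inner map
  let inner (u : FrobAlg S p e) : S ⊗[R] E →+ FrobAlg R p e ⊗[R] E :=
    TensorProduct.liftAddHom
      (AddMonoidHom.mk' (fun s => AddMonoidHom.mk' (fun y => T' (u * fr s) ⊗ₜ[R] y)
        (fun y y' => TensorProduct.tmul_add _ _ _))
        (fun s s' => by
          ext y
          simp only [AddMonoidHom.mk'_apply, AddMonoidHom.add_apply, map_add, mul_add,
            TensorProduct.add_tmul]))
      (fun r s y => by
        simp only [AddMonoidHom.mk'_apply]
        rw [← TensorProduct.smul_tmul, aux_frobAlg_smul]
        congr 1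
        have h1 : u * fr (r • s) =
            FrobAlg.of S p e (algebraMap R S (r ^ p ^ e)) * (u * fr s) := by
          rw [Algebra.smul_def, map_mul, hfr (algebraMap R S r), map_pow (algebraMap R S),
            mul_left_comm]
        rw [h1, hT'])
  have hinner : ∀ u s y, inner u (s ⊗ₜ y) = T' (u * fr s) ⊗ₜ[R] y := fun u s y => rfl
  let Ψ : FrobAlg S p e ⊗[S] (S ⊗[R] E) →+ FrobAlg R p e ⊗[R] E :=
    TensorProduct.liftAddHom
      (AddMonoidHom.mk' inner (fun u u' => by
        ext ζ
        induction ζ with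
        | zero => simp
        | add a b ha hb => simp only [map_add, ha, hb]
        | tmul s y => simp only [AddMonoidHom.add_apply, hinner, add_mul, map_add,
            TensorProduct.add_tmul]))
      (fun r u ζ => by
        simp only [AddMonoidHom.mk'_apply]
        induction ζ with
        | zero => simp
        | add a b ha hb => simp only [map_add, smul_add, ha, hb]
        | tmul s y =>
          rw [TensorProduct.smul_tmul', hinner, hinner, smul_eq_mul, map_mul fr,
            aux_frobAlg_smul, hfr r, mul_left_comm u, mul_assoc])
  have hΨ : ∀ ζ : S ⊗[R] E, Ψ (FrobAlg.of S p e (algebraMap R S c) ⊗ₜ[S] ζ) =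
      FrobAlg.of R p e c ⊗ₜ[R] (TensorProduct.lid R E (T.rTensor E ζ)) := by
    intro ζ
    change inner _ ζ = _
    induction ζ with
    | zero => simp
    | add a b ha hb => simp only [map_add, TensorProduct.tmul_add, ha, hb]
    | tmul s y =>
      have h7 : T (s ^ p ^ e) = (T s) ^ p ^ e := aux_intTrace_frob (R := R) (S := S) p e s
      have h8 : T' (fr s) = FrobAlg.of R p e ((T s) ^ p ^ e) := h7
      rw [hinner, hT', LinearMap.rTensor_tmul, TensorProduct.lid_tmul,
        ← TensorProduct.smul_tmul, aux_frobAlg_smul, mul_comm, h8]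
  have := hΨ ζ
  rw [h, map_zero] at this
  exact this.symm

theorem aux_unram_of_etale
  (hetale : ∀ (Q : Ideal S), ∀ (hQ : Q.IsPrime),
      haveI := hQ
      haveI : (Q.comap (algebraMap R S)).IsPrime := hQ.comap (algebraMap R S)
      ringKrullDim (Localization.AtPrime Q) ≤ 1 →
        letI := (Localization.localRingHom (Q.comap (algebraMap R S)) Q
          (algebraMap R S) rfl).toAlgebra
        Algebra.Etale (Localization.AtPrime (Q.comap (algebraMap R S)))
          (Localization.AtPrime Q))
    (Q : Ideal S) [hQ : Q.IsPrime] (hdim : ringKrullDim (Localization.AtPrime Q) ≤ 1) :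
    Algebra.FormallyUnramified R (Localization.AtPrime Q) := by
  have : (Q.comap (algebraMap R S)).IsPrime := hQ.comap (algebraMap R S)
  let P := Q.comap (algebraMap R S)
  letI := (Localization.localRingHom (Q.comap (algebraMap R S)) Q
          (algebraMap R S) rfl).toAlgebra
  have h1 := hetale Q hQ hdim
  have : IsScalarTower R (Localization.AtPrime P) (Localization.AtPrime Q) := by
    refine IsScalarTower.of_algebraMap_eq fun x => ?_
    rw [IsScalarTower.algebraMap_apply R S (Localization.AtPrime Q)]
    exact (Localization.localRingHom_to_map _ _ _ _ _).symm
  have : Algebra.FormallyUnramified R (Localization.AtPrime P) :=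
    Algebra.FormallyUnramified.of_isLocalization P.primeCompl
  have : Algebra.FormallyUnramified (Localization.AtPrime P) (Localization.AtPrime Q) := 
    inferInstance
  exact Algebra.FormallyUnramified.comp R (Localization.AtPrime P) (Localization.AtPrime Q)
end


section
variable {R S : Type u} [CommRing R] [CommRing S] [Algebra R S] [Module.Finite R S]
  [IsNoetherianRing R]

theorem aux_j {E E' : Type u} [AddCommGroup E] [Module R E] [AddCommGroup E'] [Module R E']
    [Module S E'] [IsScalarTower R S E'] (hE : Module.Injective R E)
    (T : S →ₗ[R] R) (hT0 : ∀ x : S, (∀ s, T (x * s) = 0) → x = 0)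
    (hT1 : ∀ φ : S →ₗ[R] R, ∃ s : S, ∀ x, φ x = T (s * x)) (g : E' →ₗ[R] E) :
    ∃ j : E' →ₗ[S] S ⊗[R] E, ∀ z, TensorProduct.lid R E (T.rTensor E (j z)) = g z := by
  let B : S →ₗ[R] (S →ₗ[R] R) := (LinearMap.mul R S).compr₂ T
  have hB : ∀ s x, B s x = T (s * x) := fun s x => rfl
  have hBb : Function.Bijective B := by
    constructor
    · rw [injective_iff_map_eq_zero]
      intro x hx
      apply hT0 x
      intro s
      rw [← hB, hx]; rfl
    · intro φ
      obtain ⟨s, hs⟩ := hT1 φ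
      exact ⟨s, by ext x; rw [hB, hs]⟩
  let Be := LinearEquiv.ofBijective B hBb
  have hBe : ∀ s, Be.symm (B s) = s := fun s => Be.symm_apply_apply s
  have key : ∀ z : E', ∃ ζ : S ⊗[R] E, ∀ s, TensorProduct.lid R E ((B s).rTensor E ζ) = g (s • z) := by
    intro z
    let h : (S →ₗ[R] R) →ₗ[R] E :=
      (g.comp ((LinearMap.toSpanSingleton S E' z).restrictScalars R)).comp Be.symm.toLinearMap
    obtain ⟨ζ, hζ⟩ := aux_dual_surj hE h
    refine ⟨ζ, fun s => ?_⟩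
    rw [hζ]
    simp [h, hBe]
  have uniq : ∀ ζ ζ' : S ⊗[R] E, (∀ s, TensorProduct.lid R E ((B s).rTensor E ζ) =
      TensorProduct.lid R E ((B s).rTensor E ζ')) → ζ = ζ' := by
    intro ζ ζ' h
    rw [← sub_eq_zero]
    apply aux_dual_inj hE
    intro φ
    obtain ⟨s, rfl⟩ := hBb.2 φ
    rw [map_sub, map_sub, h, sub_self]
  have hsm : ∀ (s s' : S) (ζ : S ⊗[R] E), (B s).rTensor E (s' • ζ) = (B (s * s')).rTensor E ζ := by
    intro s s' ζ
    induction ζ with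
    | zero => simp
    | add a b ha hb => simp only [smul_add, map_add, ha, hb]
    | tmul u y =>
      rw [TensorProduct.smul_tmul', LinearMap.rTensor_tmul, LinearMap.rTensor_tmul, hB, hB,
        smul_eq_mul, mul_assoc]
  choose j hj using key
  refine ⟨{ toFun := j, map_add' := ?_, map_smul' := ?_ }, ?_⟩
  · intro z z'
    apply uniq
    intro s
    rw [map_add, map_add, hj, hj, hj, smul_add, map_add]
  · intro c z
    apply uniq
    intro s
    rw [hj, RingHom.id_apply, hsm, hj, smul_smul]
  · intro z
    have h1 := hj z 1
    have h2 : B 1 = T := by ext x; rw [hB, one_mul]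
    rw [h2, one_smul] at h1
    exact h1

theorem aux_g [IsLocalRing R] [IsLocalRing S] [IsLocalHom (algebraMap R S)]
    {E E' : Type u} [AddCommGroup E] [Module R E] [AddCommGroup E'] [Module R E']
    [Module S E'] [IsScalarTower R S E']
    (hE : IsInjectiveHull R (R ⧸ IsLocalRing.maximalIdeal R) E)
    (hE' : IsInjectiveHull S (S ⧸ IsLocalRing.maximalIdeal S) E') :
    ∃ g : E' →ₗ[R] E, ∀ z, (∀ s : S, g (s • z) = 0) → z = 0 := by
  obtain ⟨hEi, ι, hι, -⟩ := hE
  obtain ⟨-, ι', hι', hess⟩ := hE'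
  let f : R →ₗ[R] E' := LinearMap.toSpanSingleton R E' (ι' 1)
  have hf : ∀ r, f r = ι' (Ideal.Quotient.mk _ (algebraMap R S r)) := by
    intro r
    change r • ι' 1 = _
    rw [← algebraMap_smul S r, ← map_smul, Algebra.smul_def, mul_one]
    rfl
  let k0 : (R ⧸ IsLocalRing.maximalIdeal R) →ₗ[R] E' := 
    Submodule.liftQ _ f (by
      intro r hr
      rw [LinearMap.mem_ker, hf]
      have : algebraMap R S r ∈ IsLocalRing.maximalIdeal S := by
        rw [IsLocalRing.mem_maximalIdeal, mem_nonunits_iff] at hr ⊢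
        intro h
        exact hr (isUnit_of_map_unit (algebraMap R S) r h)
      rw [Ideal.Quotient.eq_zero_iff_mem.2 this, map_zero])
  have hk0 : ∀ r, k0 (Ideal.Quotient.mk _ r) = f r := fun r => Submodule.liftQ_apply _ f r
  have hinj : Function.Injective k0 := by
    rw [injective_iff_map_eq_zero]
    intro x hx
    obtain ⟨r, rfl⟩ := Ideal.Quotient.mk_surjective x
    rw [hk0, hf, map_eq_zero_iff _ hι', Ideal.Quotient.eq_zero_iff_mem] at hx
    rw [Ideal.Quotient.eq_zero_iff_mem]
    rw [IsLocalRing.mem_maximalIdeal, mem_nonunits_iff] at hx ⊢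
    intro h
    exact hx (h.map (algebraMap R S))
  obtain ⟨g, hg⟩ := hEi.out k0 hinj ι
  refine ⟨g, fun z hz => ?_⟩
  by_contra hne
  have h1 := hess (Submodule.span S {z}) (by simpa using hne)
  rw [Submodule.ne_bot_iff] at h1
  obtain ⟨w, ⟨hw1, ⟨y, hy⟩⟩, hw0⟩ := h1
  obtain ⟨s, hs⟩ := Submodule.mem_span_singleton.1 hw1
  obtain ⟨v, rfl⟩ := Ideal.Quotient.mk_surjective y
  have hv : IsUnit v := by
    by_contra hv
    apply hw0
    rw [← hy, Ideal.Quotient.eq_zero_iff_mem.2 ((IsLocalRing.mem_maximalIdeal _).2 hv), map_zero]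
  obtain ⟨u, rfl⟩ := hv
  have h3 : ι' 1 = ((↑u⁻¹ : S) * s) • z := by
    rw [mul_smul, hs, ← hy, ← map_smul]
    congr 1
    rw [Algebra.smul_def, Ideal.Quotient.algebraMap_eq, ← map_mul, Units.inv_mul, map_one]
  have h4 : g (ι' 1) = ι 1 := by
    have := hg 1
    rw [← this]
    congr 1
    have := hk0 1
    rw [hf, map_one (algebraMap R S)] at this
    exact this.symm
  rw [h3, hz] at h4
  have h5 : (1 : R ⧸ IsLocalRing.maximalIdeal R) = 0 := hι (by rw [← h4, map_zero])
  exact one_ne_zero h5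

end

section
variable {R S : Type u} [CommRing R] [CommRing S]
    [IsDomain R] [IsDomain S] [IsIntegrallyClosed R] [IsIntegrallyClosed S] [Algebra R S]
    [Module.Finite R S] [Module.IsTorsionFree R S]

theorem aux_tc (p : ℕ) [Fact p.Prime] [CharP R p] [CharP S p] [ExpChar R p] [ExpChar S p]
    {E E' : Type u} [AddCommGroup E] [Module R E] [AddCommGroup E']
    [Module S E'] (a : Ideal R) (t : ℚ) (j : E' →ₗ[S] S ⊗[R] E) (z : E')
    (hz : z ∈ moduleTC S p (a.map (algebraMap R S)) t E') :
    TensorProduct.lid R E ((Algebra.intTrace R S).rTensor E (j z)) ∈ moduleTC R p a t E := by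
  obtain ⟨c, hc, e₀, h⟩ := hz
  rw [aux_rcirc] at hc
  obtain ⟨r0, hr0, d, hd⟩ := (Algebra.IsIntegral.isIntegral (R := R) c).isAlgebraic.exists_nonzero_dvd
    (mem_nonZeroDivisors_of_ne_zero hc)
  refine ⟨r0, (aux_rcirc r0).2 hr0, e₀, fun e he x hx => ?_⟩
  apply aux_frob_trace p e
  have hx' : algebraMap R S x ∈ (a.map (algebraMap R S)) ^ ⌈t * (p : ℚ) ^ e⌉₊ := by
    rw [← Ideal.map_pow]; exact Ideal.mem_map_of_mem _ hx
  have h1 := h e he (d * algebraMap R S x) (Ideal.mul_mem_left _ _ hx')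
  rw [← mul_assoc, ← hd, ← map_mul] at h1
  have h2 := congrArg (j.lTensor (FrobAlg S p e)) h1
  rwa [LinearMap.lTensor_tmul, map_zero] at h2

theorem aux_tc_smul {S : Type u} [CommRing S] (p : ℕ) [ExpChar S p] {E' : Type u} [AddCommGroup E']
    [Module S E'] (b : Ideal S) (t : ℚ) (z : E') (s : S)
    (hz : z ∈ moduleTC S p b t E') : s • z ∈ moduleTC S p b t E' := by
  obtain ⟨c, hc, e₀, h⟩ := hz
  refine ⟨c, hc, e₀, fun e he x hx => ?_⟩
  have := congrArg ((LinearMap.lsmul S E' s).lTensor (FrobAlg S p e)) (h e he x hx)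
  rwa [LinearMap.lTensor_tmul, map_zero] at this

end



/-- **Theorem 3.3, first assertion** (Hara–Takagi).  Let `(R,m) ↪ (S,n)` be a pure,
module-finite local homomorphism of F-finite normal local rings of characteristic `p > 0`
which is étale in codimension one, `a ⊆ R` a nonzero ideal, `t ≥ 0` rational, and assume
condition `(*)` for `aᵗ` over `R` and `(aS)ᵗ` over `S`.  Then `τ((aS)ᵗ) ∩ R = τ(aᵗ)`. -/
theorem testIdeal_pure_etale_in_codim_one_contraction
    (S : Type u) [CommRing S]
    [IsDomain R] [IsDomain S] [IsIntegrallyClosed R] [IsIntegrallyClosed S]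
    [IsNoetherianRing R] [IsNoetherianRing S] [IsLocalRing R] [IsLocalRing S]
    (p : ℕ) [Fact p.Prime] [CharP R p] [CharP S p] [ExpChar R p] [ExpChar S p]
    (hFFR : IsFFinite R p) (hFFS : IsFFinite S p)
    [Algebra R S] (hinj : Function.Injective (algebraMap R S))
    [IsLocalHom (algebraMap R S)] [Module.Finite R S]
    (hpure : ∀ (M : Type u) [AddCommGroup M] [Module R M],
      Function.Injective (fun m : M => (m ⊗ₜ[R] (1 : S) : TensorProduct R M S)))
    (hetale : ∀ (Q : Ideal S), ∀ (hQ : Q.IsPrime),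
      haveI := hQ
      haveI : (Q.comap (algebraMap R S)).IsPrime := hQ.comap (algebraMap R S)
      ringKrullDim (Localization.AtPrime Q) ≤ 1 →
        letI := (Localization.localRingHom (Q.comap (algebraMap R S)) Q
          (algebraMap R S) rfl).toAlgebra
        Algebra.Etale (Localization.AtPrime (Q.comap (algebraMap R S)))
          (Localization.AtPrime Q))
    (a : Ideal R) (ha : a ≠ ⊥) (t : ℚ) (ht : 0 ≤ t)
    (E : Type u) [AddCommGroup E] [Module R E]
    (hE : IsInjectiveHull R (R ⧸ IsLocalRing.maximalIdeal R) E)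
    (hstar : testIdeal R p a t = tildeTau R p a t E)
    (E' : Type u) [AddCommGroup E'] [Module S E']
    (hE' : IsInjectiveHull S (S ⧸ IsLocalRing.maximalIdeal S) E')
    (hstar' : testIdeal S p (a.map (algebraMap R S)) t
      = tildeTau S p (a.map (algebraMap R S)) t E') :
    (testIdeal S p (a.map (algebraMap R S)) t).comap (algebraMap R S)
      = testIdeal R p a t := by
  refine le_antisymm (aux_easy p hinj hpure a t) ?_
  have : FaithfulSMul R S := (faithfulSMul_iff_algebraMap_injective R S).2 hinj
  have : Module.IsTorsionFree R S := inferInstance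
  have hθ : ∀ (Q : Ideal S) [Q.IsPrime], ringKrullDim (Localization.AtPrime Q) ≤ 1 →
      ∃ θ : S ⊗[R] S, Algebra.TensorProduct.lmul' R θ ∉ Q ∧
      ∀ s : S, (s ⊗ₜ[R] (1 : S)) * θ = ((1 : S) ⊗ₜ[R] s) * θ := fun Q _ hdim =>
    aux_theta Q (aux_unram_of_etale hetale Q hdim)
  obtain ⟨θ₀, h0, h1⟩ := hθ ⊥ (by
    rw [IsLocalization.AtPrime.ringKrullDim_eq_height (⊥ : Ideal S)]
    simp)
  have h0' : Algebra.TensorProduct.lmul' R θ₀ ≠ 0 := by simpa using h0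
  letI : Module R E' := Module.compHom E' (algebraMap R S)
  have : IsScalarTower R S E' := IsScalarTower.of_algebraMap_smul fun r x => rfl
  obtain ⟨g, hg⟩ := aux_g hE hE'
  obtain ⟨j, hj⟩ := aux_j hE.1 (Algebra.intTrace R S) (aux_trace_nondeg θ₀ h1 h0')
    (aux_trace_surj hθ θ₀ h1 h0') g
  rw [hstar, hstar']
  intro r hr
  rw [Ideal.mem_comap, tildeTau, Submodule.mem_annihilator_span]
  rw [tildeTau, Submodule.mem_annihilator_span] at hr
  rintro ⟨z, hz⟩
  apply hg
  intro s
  have h2 := aux_tc p a t j (s • z) (aux_tc_smul p _ t z s hz)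
  rw [hj] at h2
  have h3 := hr ⟨_, h2⟩
  rw [← h3, ← map_smul]
  congr 1
  change s • (algebraMap R S r) • z = r • s • z
  rw [algebraMap_smul, smul_comm]
end

section
/- Let (R,m) ↪ (S,n) be a pure, module-finite, flat local homomorphism of F-finite normal local rings of prime characteristic p > 0 which is étale in codimension one. Let a be a nonzero ideal of R and t ≥ 0 a rational number, and assume that condition (*) is satisfied for a^t over R and for (aS)^t over S. Then τ((aS)^t) = τ(a^t)·S. -/
open scoped TensorProduct

universe u

variable (R : Type u) [CommRing R]

theorem aux_height {R S : Type u} [CommRing R] [CommRing S] [Algebra R S] [Algebra.IsIntegral R S]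
    (Q : Ideal S) [Q.IsPrime] : Q.height ≤ (Q.comap (algebraMap R S)).height := by
  have h := Order.height_le_height_apply_of_strictMono
    (PrimeSpectrum.comap (algebraMap R S))
    (fun I J hIJ => by
      have : I.asIdeal < J.asIdeal := hIJ
      exact Ideal.IsIntegral.comap_lt_comap (R := R) this) ⟨Q, inferInstance⟩
  rw [← PrimeSpectrum.height_eq_orderHeight, ← PrimeSpectrum.height_eq_orderHeight] at h
  exact h

theorem aux_unram {R S : Type u} [CommRing R] [CommRing S] [Algebra R S]
    (Q : Ideal S) [Q.IsPrime] [hP : (Q.comap (algebraMap R S)).IsPrime]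
    (h : letI := (Localization.localRingHom (Q.comap (algebraMap R S)) Q
          (algebraMap R S) rfl).toAlgebra
        Algebra.Etale (Localization.AtPrime (Q.comap (algebraMap R S)))
          (Localization.AtPrime Q)) (w : Ω[S⁄R]) : ∃ s ∉ Q, s • w = 0 := by
  let _ := (Localization.localRingHom (Q.comap (algebraMap R S)) Q
          (algebraMap R S) rfl).toAlgebra
  have : IsScalarTower R (Localization.AtPrime (Q.comap (algebraMap R S)))
      (Localization.AtPrime Q) := by
    refine IsScalarTower.of_algebraMap_eq fun x => ?_
    rw [RingHom.algebraMap_toAlgebra, Localization.localRingHom_to_map]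
    exact IsScalarTower.algebraMap_apply R S (Localization.AtPrime Q) x
  have : Algebra.FormallyUnramified R (Localization.AtPrime (Q.comap (algebraMap R S))) :=
    Algebra.FormallyUnramified.of_isLocalization (Q.comap (algebraMap R S)).primeCompl
  have : Algebra.FormallyUnramified (Localization.AtPrime (Q.comap (algebraMap R S)))
      (Localization.AtPrime Q) := by
    have := h.formallyEtale
    infer_instance
  have : Algebra.FormallyUnramified R (Localization.AtPrime Q) :=
    Algebra.FormallyUnramified.comp R (Localization.AtPrime (Q.comap (algebraMap R S))) _
  have hs : KaehlerDifferential.map R R S (Localization.AtPrime Q) w = 0 := Subsingleton.elim _ _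
  obtain ⟨c, hc⟩ := (IsLocalizedModule.eq_zero_iff Q.primeCompl
    (KaehlerDifferential.map R R S (Localization.AtPrime Q))).1 hs
  exact ⟨c, c.2, hc⟩

theorem aux_kill {R S : Type u} [CommRing R] [CommRing S] [Algebra R S] [Module.Finite R S]
    (P : Ideal R) [P.IsPrime]
    (h : ∀ Q : Ideal S, Q.IsPrime → Q.comap (algebraMap R S) ≤ P →
      ∀ w : Ω[S⁄R], ∃ s ∉ Q, s • w = 0) :
    ∃ f ∉ P, ∀ w : Ω[S⁄R], algebraMap R S f • w = 0 := by
  set I : Ideal S := Module.annihilator S Ω[S⁄R] with hI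
  by_contra! hcon
  have hdis : Disjoint (I : Set S) (P.primeCompl.map (algebraMap R S) : Set S) := by
    rw [Set.disjoint_left]
    rintro x hx ⟨f, hf, rfl⟩
    obtain ⟨w, hw⟩ := hcon f hf
    exact hw (Module.mem_annihilator.1 hx w)
  obtain ⟨Q, hQ, hIQ, hdQ⟩ := Ideal.exists_le_prime_disjoint _ _ hdis
  have hQP : Q.comap (algebraMap R S) ≤ P := by
    intro x hx
    by_contra hxP
    exact Set.disjoint_left.1 hdQ hx ⟨x, hxP, rfl⟩
  have hsub : Subsingleton (LocalizedModule Q.primeCompl Ω[S⁄R]) := by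
    rw [LocalizedModule.subsingleton_iff]
    intro w
    obtain ⟨s, hs, hw⟩ := h Q hQ hQP w
    exact ⟨s, hs, hw⟩
  have := (Module.notMem_support_iff (R := S) (M := Ω[S⁄R]) (p := ⟨Q, hQ⟩)).2 hsub
  rw [Module.mem_support_iff_of_finite] at this
  exact this hIQ

theorem aux_sep {R S : Type u} [CommRing R] [CommRing S] [Algebra R S] [Module.Finite R S]
    (f : R) (h : ∀ w : Ω[S⁄R], algebraMap R S f • w = 0) :
    ∃ (n : ℕ) (e : S ⊗[R] S), Algebra.TensorProduct.lmul' R e = algebraMap R S (f ^ n) ∧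
      ∀ s : S, e * (s ⊗ₜ 1) = e * (1 ⊗ₜ s) := by
  set J := KaehlerDifferential.ideal R S with hJ
  have hfg : J.FG := KaehlerDifferential.ideal_fg R S
  have : Module.Finite (S ⊗[R] S) J := Module.Finite.iff_fg.2 hfg
  set F : S ⊗[R] S := algebraMap R S f ⊗ₜ 1 with hF
  have hrange : LinearMap.range (algebraMap (S ⊗[R] S) (Module.End (S ⊗[R] S) J) F) ≤
      J • (⊤ : Submodule (S ⊗[R] S) J) := by
    rintro _ ⟨x, rfl⟩
    have h1 := h (KaehlerDifferential.fromIdeal R S x)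
    have h2 : KaehlerDifferential.fromIdeal R S (F • x) = 0 := by
      rw [map_smul, ← h1]
      exact algebraMap_smul (S ⊗[R] S) (algebraMap R S f) (KaehlerDifferential.fromIdeal R S x)
    have := (Submodule.Quotient.mk_eq_zero _).1 h2
    simpa using this
  obtain ⟨g, hg, -, hco, hae⟩ :=
    LinearMap.exists_monic_and_natDegree_eq_and_coeff_mem_pow_and_aeval_eq_zero _ _ J hrange
  refine ⟨g.natDegree, g.eval F, ?_, ?_⟩
  · have hmap : g.map (Algebra.TensorProduct.lmul' (S := S) R).toRingHom
        = Polynomial.X ^ g.natDegree := by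
      ext k
      rw [Polynomial.coeff_map, Polynomial.coeff_X_pow]
      split_ifs with hk
      · subst hk; rw [Polynomial.coeff_natDegree, hg]; simp
      · rcases lt_or_gt_of_ne hk with hk | hk
        · have h3 := Ideal.pow_le_self (by omega) (hco k)
          exact h3
        · rw [Polynomial.coeff_eq_zero_of_natDegree_lt hk]; simp
    have : Algebra.TensorProduct.lmul' (S := S) R (g.eval F) =
        (g.map (Algebra.TensorProduct.lmul' (S := S) R).toRingHom).eval
          (Algebra.TensorProduct.lmul' (S := S) R F) := by
      rw [Polynomial.eval_map]
      exact Polynomial.hom_eval₂ g (RingHom.id _) (Algebra.TensorProduct.lmul' (S := S) R).toRingHom F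
    rw [this, hmap]
    simp [hF]
  · intro s
    rw [Polynomial.aeval_algebraMap_apply] at hae
    have hx := KaehlerDifferential.one_smul_sub_smul_one_mem_ideal R s
    have := congrArg Subtype.val (LinearMap.congr_fun hae ⟨_, hx⟩)
    simp at this
    rw [mul_sub, sub_eq_zero] at this
    exact this.symm

theorem aux_span {R S : Type u} [CommRing R] [CommRing S] [Algebra R S]
    (p : ℕ) [ExpChar S p] (k : ℕ) {ι : Type*} [Fintype ι] (b : Module.Basis ι R S)
    (f : S) (e : S ⊗[R] S) (he : Algebra.TensorProduct.lmul' R e = f)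
    (hes : ∀ s : S, e * (s ⊗ₜ 1) = e * (1 ⊗ₜ s)) (s : S) :
    f ^ p ^ k * s ∈ Submodule.span R (Set.range fun i => b i ^ p ^ k) := by
  have hinj : Function.Injective
      (Algebra.TensorProduct.includeLeft : S →ₐ[R] S ⊗[R] S).toRingHom := by
    intro x y hxy
    have := congrArg (Algebra.TensorProduct.lmul' R) hxy
    simpa using this
  have : ExpChar (S ⊗[R] S) p := expChar_of_injective_ringHom hinj p
  set T := Submodule.span R (Set.range fun i => b i ^ p ^ k) with hT
  have hpow : ∀ y : S, y ^ p ^ k ∈ T := by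
    intro y
    rw [← b.sum_repr y, ← iterateFrobenius_def, map_sum]
    refine Submodule.sum_mem _ fun i _ => ?_
    rw [Algebra.smul_def, map_mul, iterateFrobenius_def, iterateFrobenius_def, ← map_pow,
      ← Algebra.smul_def]
    exact Submodule.smul_mem _ _ (Submodule.subset_span ⟨i, rfl⟩)
  let g : (S →ₗ[R] R) → S ⊗[R] S →ₗ[R] S := fun φ =>
    (TensorProduct.lid R S).toLinearMap ∘ₗ LinearMap.rTensor S φ
  have hg : ∀ φ x y, g φ (x ⊗ₜ y) = φ x • y := fun φ x y => by simp [g]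
  have hA : ∀ φ (y : S ⊗[R] S) (s : S), g φ (y ^ p ^ k * (s ⊗ₜ 1)) ∈ T := by
    intro φ y s
    induction y using TensorProduct.induction_on with
    | zero => simp [(expChar_pos S p).ne']
    | tmul x y =>
      rw [Algebra.TensorProduct.tmul_pow, Algebra.TensorProduct.tmul_mul_tmul, hg, mul_one]
      exact Submodule.smul_mem _ _ (hpow y)
    | add x y hx hy =>
      rw [add_pow_expChar_pow, add_mul, map_add]
      exact Submodule.add_mem _ hx hy
  have hB : ∀ φ (y : S ⊗[R] S) (s : S), g φ (y * (1 ⊗ₜ s)) = g φ y * s := by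
    intro φ y s
    induction y using TensorProduct.induction_on with
    | zero => simp
    | tmul x y => simp [hg]
    | add x y hx hy => rw [add_mul, map_add, hx, hy, map_add, add_mul]
  have hC : ∀ y : S ⊗[R] S, Algebra.TensorProduct.lmul' R y = ∑ i, b i * g (b.coord i) y := by
    intro y
    induction y using TensorProduct.induction_on with
    | zero => simp
    | tmul x y =>
      simp only [hg, Algebra.TensorProduct.lmul'_apply_tmul]
      conv_lhs => rw [← b.sum_repr x, Finset.sum_mul]
      simp
    | add x y hx hy => simp only [map_add, hx, hy, mul_add, Finset.sum_add_distrib]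
  rw [← he, ← map_pow, hC, Finset.sum_mul]
  refine Submodule.sum_mem _ fun i _ => ?_
  have h1 : e ^ p ^ k * (1 ⊗ₜ (b i * s)) = e ^ p ^ k * ((b i * s) ⊗ₜ 1) := by
    obtain ⟨m, hm⟩ := Nat.exists_eq_succ_of_ne_zero (pow_pos (expChar_pos S p) k).ne'
    rw [hm, pow_succ, mul_assoc, mul_assoc, hes]
  have h2 : b i * g (b.coord i) (e ^ p ^ k) * s = g (b.coord i) (e ^ p ^ k) * (b i * s) := by ring
  rw [h2, ← hB, h1]
  exact hA _ _ _

theorem aux_basis {R S : Type u} [CommRing R] [CommRing S] [IsNoetherianRing R]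
    [Algebra R S] [Module.Finite R S] (p : ℕ) [ExpChar S p]
    (hetale : ∀ (Q : Ideal S), ∀ (hQ : Q.IsPrime),
      haveI := hQ
      haveI : (Q.comap (algebraMap R S)).IsPrime := hQ.comap (algebraMap R S)
      ringKrullDim (Localization.AtPrime Q) ≤ 1 →
        letI := (Localization.localRingHom (Q.comap (algebraMap R S)) Q
          (algebraMap R S) rfl).toAlgebra
        Algebra.Etale (Localization.AtPrime (Q.comap (algebraMap R S)))
          (Localization.AtPrime Q)) (k : ℕ)
    {ι : Type*} [Fintype ι] (b : Module.Basis ι R S) :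
    ∃ β : Module.Basis ι R S, ∀ i, β i = b i ^ p ^ k := by
  classical
  set v : ι → S := fun i => b i ^ p ^ k with hv
  suffices h : IsUnit (b.det v) by
    obtain ⟨h1, h2⟩ := b.is_basis_iff_det.2 h
    exact ⟨Module.Basis.mk h1 h2.ge, fun i => by simp [hv]⟩
  by_contra hnu
  obtain ⟨P, hP⟩ : (Ideal.span {b.det v}).minimalPrimes.Nonempty :=
    Set.nonempty_coe_sort.1 (Ideal.nonempty_minimalPrimes (by rwa [Ne, Ideal.span_singleton_eq_top]))
  have hPp : P.IsPrime := hP.isPrime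
  have hht := Ideal.height_le_one_of_isPrincipal_of_mem_minimalPrimes _ P hP
  have hdet : b.det v ∈ P := hP.1.2 (Ideal.mem_span_singleton_self _)
  obtain ⟨f, hfP, hf⟩ := aux_kill (S := S) P (by
    intro Q hQ hQP w
    have : (Q.comap (algebraMap R S)).IsPrime := hQ.comap (algebraMap R S)
    refine aux_unram Q (hetale Q hQ ?_) w
    rw [IsLocalization.AtPrime.ringKrullDim_eq_height Q]
    exact_mod_cast (aux_height (R := R) Q).trans ((Ideal.height_mono hQP).trans hht))
  obtain ⟨n, e, he, hes⟩ := aux_sep f hf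
  have hsp := fun j => aux_span p k b _ e he hes (b j)
  simp only [Submodule.mem_span_range_iff_exists_fun] at hsp
  choose X hX using hsp
  have hM : b.toMatrix v * Matrix.of (fun i j => X j i) = Matrix.scalar ι ((f ^ n) ^ p ^ k) := by
    ext i j
    rw [Matrix.mul_apply]
    have := congrArg (fun y => b.repr y i) (hX j)
    rw [← map_pow, ← Algebra.smul_def] at this
    simp only [map_sum, map_smul, Finsupp.coe_finset_sum, Finset.sum_apply, Finsupp.smul_apply,
      smul_eq_mul, Module.Basis.repr_self] at this
    simp only [Module.Basis.toMatrix_apply, Matrix.of_apply, Matrix.scalar_apply,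
      Matrix.diagonal_apply]
    rw [show (∑ x, b.repr (v x) i * X j x) = ∑ x, X j x * b.repr (v x) i from
      Finset.sum_congr rfl fun _ _ => mul_comm _ _, this, Finsupp.single_apply]
    simp [eq_comm]
  have hd := congrArg Matrix.det hM
  rw [Matrix.det_mul, ← Module.Basis.det_apply] at hd
  have hmem : ((f ^ n) ^ p ^ k) ^ Fintype.card ι ∈ P := by
    have : (Matrix.scalar ι ((f ^ n) ^ p ^ k)).det = ((f ^ n) ^ p ^ k) ^ Fintype.card ι := by
      simp
    rw [← this, ← hd]
    exact P.mul_mem_right _ hdet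
  exact hfP (hPp.mem_of_pow_mem _ (hPp.mem_of_pow_mem _ (hPp.mem_of_pow_mem _ hmem)))

theorem aux_Rcirc {A : Type u} [CommRing A] [IsDomain A] (c : A) : c ∈ Rcirc A ↔ c ≠ 0 := by
  unfold Rcirc
  simp [IsDomain.minimalPrimes_eq_singleton_bot]

theorem aux_map {R S : Type u} [CommRing R] [CommRing S] [Algebra R S]
    (p : ℕ) [ExpChar R p] [ExpChar S p] (k : ℕ)
    {ι : Type*} [Fintype ι] (b β : Module.Basis ι R S) (hβ : ∀ i, β i = b i ^ p ^ k)
    (E : Type u) [AddCommGroup E] [Module R E] (E' : Type u) [AddCommGroup E'] [Module S E']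
    [Module R E'] [IsScalarTower R S E'] (φ : E' →ₗ[R] E) (r : R) (z : E')
    (h : (FrobAlg.of S p k (algebraMap R S r)) ⊗ₜ[S] z = (0 : FrobAlg S p k ⊗[S] E')) :
    (FrobAlg.of R p k r) ⊗ₜ[R] φ z = (0 : FrobAlg R p k ⊗[R] E) := by
  have hsm : ∀ (c r : R) (w : E), (FrobAlg.of R p k (c ^ p ^ k * r)) ⊗ₜ[R] w
      = (FrobAlg.of R p k r) ⊗ₜ[R] (c • w) := by
    intro c r w
    rw [← TensorProduct.smul_tmul]
    rfl
  let f : FrobAlg S p k →+ E' →+ FrobAlg R p k ⊗[R] E :=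
    AddMonoidHom.mk' (fun s : S => AddMonoidHom.mk'
      (fun z => ∑ i, (FrobAlg.of R p k (β.repr s i)) ⊗ₜ[R] φ (b i • z))
      (fun x y => by
        simp only [smul_add, map_add, TensorProduct.tmul_add, Finset.sum_add_distrib]))
      (fun (x y : S) => by
        ext z
        change (∑ i, (FrobAlg.of R p k (β.repr (x + y) i)) ⊗ₜ[R] φ (b i • z)) = 
          (∑ i, (FrobAlg.of R p k (β.repr x i)) ⊗ₜ[R] φ (b i • z)) +
          (∑ i, (FrobAlg.of R p k (β.repr y i)) ⊗ₜ[R] φ (b i • z))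
        simp only [map_add, Finsupp.add_apply, TensorProduct.add_tmul, Finset.sum_add_distrib])
  have hfdef : ∀ (s : S) (z : E'), f (FrobAlg.of S p k s) z =
    ∑ i, (FrobAlg.of R p k (β.repr s i)) ⊗ₜ[R] φ (b i • z) := fun _ _ => rfl
  have key : ∀ (r : R) (s : S) (z : E'), f (FrobAlg.of S p k (r • s ^ p ^ k)) z
      = (FrobAlg.of R p k r) ⊗ₜ[R] φ (s • z) := by
    intro r s z
    have h1 : r • s ^ p ^ k = ∑ i, ((b.repr s i) ^ p ^ k * r) • β i := by
      conv_lhs => rw [← b.sum_repr s, ← iterateFrobenius_def, map_sum, Finset.smul_sum]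
      refine Finset.sum_congr rfl fun i _ => ?_
      rw [Algebra.smul_def (b.repr s i), map_mul, iterateFrobenius_def, iterateFrobenius_def,
        ← map_pow, ← Algebra.smul_def, smul_smul, hβ, mul_comm]
    rw [hfdef, h1]
    simp only [Module.Basis.repr_sum_self, hsm]
    rw [← TensorProduct.tmul_sum]
    congr 1
    conv_rhs => rw [← b.sum_repr s, Finset.sum_smul]
    simp only [smul_assoc, map_sum, map_smul]
  have bal : ∀ (c : S) (m : FrobAlg S p k) (n : E'), f (c • m) n = f m (c • n) := by
    intro c m n
    obtain ⟨s, rfl⟩ : ∃ s : S, FrobAlg.of S p k s = m := ⟨m, rfl⟩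
    have h0 : c • FrobAlg.of S p k s = FrobAlg.of S p k (c ^ p ^ k * s) := rfl
    rw [h0]
    rw [← β.sum_repr s, Finset.mul_sum]
    simp only [map_sum, AddMonoidHom.finset_sum_apply, hβ]
    refine Finset.sum_congr rfl fun i _ => ?_
    rw [key, mul_smul_comm, ← mul_pow, key, mul_comm, mul_smul]
  have h2 := congrArg (TensorProduct.liftAddHom f bal) h
  rw [TensorProduct.liftAddHom_tmul, map_zero] at h2
  have h3 := key r 1 z
  rw [one_pow, one_smul, ← Algebra.algebraMap_eq_smul_one, h2] at h3
  exact h3.symm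

theorem aux_sep_inj {R : Type u} [CommRing R] [IsLocalRing R]
    (E : Type u) [AddCommGroup E] [Module R E]
    (hE : IsInjectiveHull R (R ⧸ IsLocalRing.maximalIdeal R) E)
    (E' : Type u) [AddCommGroup E'] [Module R E'] (w : E') (hw : w ≠ 0) :
    ∃ φ : E' →ₗ[R] E, φ w ≠ 0 := by
  obtain ⟨hI, ι, hι, -⟩ := hE
  let l := LinearMap.toSpanSingleton R E' w
  have hker : LinearMap.ker l ≤ IsLocalRing.maximalIdeal R := by
    apply IsLocalRing.le_maximalIdeal
    intro h
    have : (1 : R) ∈ LinearMap.ker l := h ▸ Submodule.mem_top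
    exact hw (by simpa [l] using this)
  let j := (LinearMap.ker l).liftQ l le_rfl
  have hj : Function.Injective j := LinearMap.ker_eq_bot.1 (Submodule.ker_liftQ_eq_bot' _ _ rfl)
  let g : (R ⧸ LinearMap.ker l) →ₗ[R] E := ι ∘ₗ Submodule.factor hker
  obtain ⟨φ, hφ⟩ := hI.out j hj g
  refine ⟨φ, fun h => ?_⟩
  have h1 := hφ (Submodule.Quotient.mk 1)
  have h2 : j (Submodule.Quotient.mk 1) = w := by
    change l 1 = w
    simp [l]
  rw [h2, h] at h1
  have h3 : Submodule.factor hker (Submodule.Quotient.mk 1) = 0 := hι (by rw [map_zero]; exact h1.symm)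
  have h4 : (Submodule.Quotient.mk 1 : R ⧸ IsLocalRing.maximalIdeal R) = 0 := h3
  rw [Submodule.Quotient.mk_eq_zero] at h4
  exact (Ideal.ne_top_iff_one _).1 (IsLocalRing.maximalIdeal.isMaximal R).ne_top h4

theorem aux_dir1 {R S : Type u} [CommRing R] [CommRing S] [IsDomain R] [IsDomain S] [Algebra R S]
    (hinj : Function.Injective (algebraMap R S)) {ι : Type*} [Fintype ι] (b : Module.Basis ι R S)
    (p : ℕ) (a : Ideal R) (t : ℚ) :
    testIdeal S p (a.map (algebraMap R S)) t ≤ (testIdeal R p a t).map (algebraMap R S) := by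
  intro s hs
  have hmem : ∀ i, b.repr s i ∈ testIdeal R p a t := by
    intro i
    unfold testIdeal
    rw [Ideal.mem_iInf]
    intro J
    have hcol : Ideal.span (tightClosure R p a t J) ≤
        Submodule.comap (LinearMap.lsmul R R (b.repr s i)) J := by
      rw [Ideal.span_le]
      rintro z ⟨c, hc, e₀, hz⟩
      have hz' : algebraMap R S z ∈ tightClosure S p (a.map (algebraMap R S)) t
          (J.map (algebraMap R S)) := by
        refine ⟨algebraMap R S c, ?_, e₀, ?_⟩
        · rw [aux_Rcirc] at hc ⊢
          rwa [Ne, map_eq_zero_iff _ hinj]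
        · intro e he x hx
          rw [← Ideal.map_pow] at hx
          have hF : (frobPow R J (p ^ e)).map (algebraMap R S) ≤
              frobPow S (J.map (algebraMap R S)) (p ^ e) := by
            unfold frobPow
            rw [Ideal.map_span, Ideal.span_le]
            rintro _ ⟨_, ⟨y, hy, rfl⟩, rfl⟩
            exact Ideal.subset_span ⟨algebraMap R S y, Ideal.mem_map_of_mem _ hy, by simp⟩
          have hle : (a ^ ⌈t * (p : ℚ) ^ e⌉₊).map (algebraMap R S) ≤
              (frobPow S (J.map (algebraMap R S)) (p ^ e)).colon
                {algebraMap R S c * algebraMap R S z ^ p ^ e} := by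
            rw [Ideal.map_le_iff_le_comap]
            intro y hy
            rw [Ideal.mem_comap, Submodule.mem_colon_singleton, smul_eq_mul, mul_comm]
            refine hF ?_
            have := Ideal.mem_map_of_mem (algebraMap R S) (hz e he y hy)
            simpa using this
          have := hle hx
          rwa [Submodule.mem_colon_singleton, smul_eq_mul, mul_comm] at this
      have h1 : s * algebraMap R S z ∈ J.map (algebraMap R S) := by
        have h2 := (Ideal.mem_iInf.1 hs) (J.map (algebraMap R S))
        rw [Submodule.mem_colon] at h2
        exact h2 _ (Ideal.subset_span hz')
      have h3 : ∀ y ∈ J.map (algebraMap R S), b.repr y i ∈ J := by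
        intro y hy
        rw [Ideal.map] at hy
        refine Submodule.span_induction ?_ ?_ ?_ ?_ hy (p := fun y _ => ∀ u : S, b.repr (u * y) i ∈ J) 1 |> fun h => by simpa using h
        · rintro _ ⟨x, hx, rfl⟩ u
          rw [mul_comm, ← Algebra.smul_def]
          simpa using J.mul_mem_right _ hx
        · simp
        · intro x y _ _ hx hy u
          rw [mul_add]
          simpa using J.add_mem (hx u) (hy u)
        · intro v x _ hx u
          rw [smul_eq_mul, ← mul_assoc]
          exact hx _
      have h4 := h3 _ h1
      rw [mul_comm, ← Algebra.smul_def] at h4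
      simpa [mul_comm] using h4
    rw [Submodule.mem_colon]
    intro z hz
    exact hcol hz
  rw [← b.sum_repr s]
  refine Ideal.sum_mem _ fun i _ => ?_
  rw [Algebra.smul_def]
  exact Ideal.mul_mem_right _ _ (Ideal.mem_map_of_mem _ (hmem i))

/-- **Theorem 3.3, second assertion** (Hara–Takagi).  Let `(R,m) ↪ (S,n)` be a pure,
module-finite, flat local homomorphism of F-finite normal local rings of characteristic
`p > 0` which is étale in codimension one, `a ⊆ R` a nonzero ideal, `t ≥ 0` rational, and
assume condition `(*)` for `aᵗ` over `R` and `(aS)ᵗ` over `S`.  Then `τ((aS)ᵗ) = τ(aᵗ)S`. -/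
theorem testIdeal_pure_etale_in_codim_one_flat_extension
    (S : Type u) [CommRing S]
    [IsDomain R] [IsDomain S] [IsIntegrallyClosed R] [IsIntegrallyClosed S]
    [IsNoetherianRing R] [IsNoetherianRing S] [IsLocalRing R] [IsLocalRing S]
    (p : ℕ) [Fact p.Prime] [CharP R p] [CharP S p] [ExpChar R p] [ExpChar S p]
    (hFFR : IsFFinite R p) (hFFS : IsFFinite S p)
    [Algebra R S] (hinj : Function.Injective (algebraMap R S))
    [IsLocalHom (algebraMap R S)] [Module.Finite R S] [Module.Flat R S]
    (hpure : ∀ (M : Type u) [AddCommGroup M] [Module R M],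
      Function.Injective (fun m : M => (m ⊗ₜ[R] (1 : S) : TensorProduct R M S)))
    (hetale : ∀ (Q : Ideal S), ∀ (hQ : Q.IsPrime),
      haveI := hQ
      haveI : (Q.comap (algebraMap R S)).IsPrime := hQ.comap (algebraMap R S)
      ringKrullDim (Localization.AtPrime Q) ≤ 1 →
        letI := (Localization.localRingHom (Q.comap (algebraMap R S)) Q
          (algebraMap R S) rfl).toAlgebra
        Algebra.Etale (Localization.AtPrime (Q.comap (algebraMap R S)))
          (Localization.AtPrime Q))
    (a : Ideal R) (ha : a ≠ ⊥) (t : ℚ) (ht : 0 ≤ t)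
    (E : Type u) [AddCommGroup E] [Module R E]
    (hE : IsInjectiveHull R (R ⧸ IsLocalRing.maximalIdeal R) E)
    (hstar : testIdeal R p a t = tildeTau R p a t E)
    (E' : Type u) [AddCommGroup E'] [Module S E']
    (hE' : IsInjectiveHull S (S ⧸ IsLocalRing.maximalIdeal S) E')
    (hstar' : testIdeal S p (a.map (algebraMap R S)) t
      = tildeTau S p (a.map (algebraMap R S)) t E') :
    testIdeal S p (a.map (algebraMap R S)) t
      = (testIdeal R p a t).map (algebraMap R S) := by
  have hfree : Module.Free R S := Module.free_of_flat_of_isLocalRing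
  let b := Module.Free.chooseBasis R S
  apply le_antisymm (aux_dir1 hinj b p a t)
  rw [hstar', Ideal.map_le_iff_le_comap]
  intro r hr
  rw [hstar] at hr
  letI : Module R E' := Module.compHom E' (algebraMap R S)
  haveI : IsScalarTower R S E' := IsScalarTower.of_algebraMap_smul fun r x => rfl
  rw [Ideal.mem_comap]
  unfold tildeTau at hr ⊢
  rw [Submodule.mem_annihilator_span] at hr ⊢
  rintro ⟨z, c, hc, e₀, hz⟩
  by_contra hne
  obtain ⟨φ, hφ⟩ := aux_sep_inj E hE E' (r • z) (by rw [← algebraMap_smul S r z]; exact hne)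
  rw [map_smul] at hφ
  refine hφ (hr ⟨φ z, ?_⟩)
  rw [aux_Rcirc] at hc
  obtain ⟨c', d, hd, hcd⟩ := (Algebra.IsAlgebraic.isAlgebraic (R := R) c).exists_smul_eq_mul 1
    (mem_nonZeroDivisors_of_ne_zero hc)
  rw [← Algebra.algebraMap_eq_smul_one] at hcd
  refine ⟨d, (aux_Rcirc d).2 hd, e₀, fun e he x hx => ?_⟩
  obtain ⟨β, hβ⟩ := aux_basis (R := R) (S := S) p hetale e b
  refine aux_map p e b β hβ E E' φ (d * x) z ?_
  have h1 := hz e he (algebraMap R S x) (by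
    rw [← Ideal.map_pow]; exact Ideal.mem_map_of_mem _ hx)
  have h2 : algebraMap R S (d * x) = c' * (c * algebraMap R S x) := by
    rw [map_mul, hcd]; ring
  rw [h2, map_mul]
  have h3 := congrArg (fun y => (FrobAlg.of S p e c') • y) h1
  simpa [TensorProduct.smul_tmul'] using h3
end

section
/- Let (R,m) be a complete Noetherian reduced local ring of prime characteristic p > 0, and let a ⊆ R be an ideal of positive height possessing a reduction generated by l elements. Let b be an ideal of R with b ∩ R° ≠ ∅ and let t ≥ 0 be a rational number. Then τ(a^l·b^t) = τ(a^{l-1}·b^t)·a. -/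
open scoped TensorProduct

universe u

variable (R : Type u) [CommRing R]

/-- The `aˢ·bᵗ`-tight closure of an ideal `J` (bi-exponent version). -/
def tightClosure2 (p : ℕ) (a b : Ideal R) (s : ℕ) (t : ℚ) (J : Ideal R) : Set R :=
  {z : R | ∃ c ∈ Rcirc R, ∃ e₀ : ℕ, ∀ e : ℕ, e₀ ≤ e →
    ∀ x ∈ a ^ (s * p ^ e) * b ^ ⌈t * (p : ℚ) ^ e⌉₊,
      c * z ^ p ^ e * x ∈ frobPow R J (p ^ e)}

/-- The generalized test ideal `τ(aˢ·bᵗ)`. -/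
def testIdeal2 (p : ℕ) (a b : Ideal R) (s : ℕ) (t : ℚ) : Ideal R :=
  ⨅ J : Ideal R, Submodule.colon J (Ideal.span (tightClosure2 R p a b s t J))
namespace SkodaAux
open IsLocalRing

section Basic
variable {A : Type*} [CommRing A]

/-- `I` is maximal among the ideals not containing `s`. -/
def Good (I : Ideal A) (s : A) : Prop := s ∉ I ∧ ∀ J : Ideal A, I ≤ J → s ∉ J → J = I

theorem exists_good [IsNoetherianRing A] (K : Ideal A) (s : A) (hs : s ∉ K) :
    ∃ I : Ideal A, K ≤ I ∧ Good I s := by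
  obtain ⟨I, ⟨hKI, hsI⟩, hmax⟩ := set_has_maximal_iff_noetherian.mpr
    (inferInstance : IsNoetherian A A) {I : Ideal A | K ≤ I ∧ s ∉ I} ⟨K, le_refl K, hs⟩
  refine ⟨I, hKI, hsI, fun J hIJ hsJ => ?_⟩
  by_contra hne
  exact hmax J ⟨hKI.trans hIJ, hsJ⟩ (lt_of_le_of_ne hIJ (Ne.symm hne))

theorem Good.mem_of_lt {I : Ideal A} {s : A} (h : Good I s) {J : Ideal A} (hIJ : I ≤ J)
    {z : A} (hz : z ∈ J) (hzI : z ∉ I) : s ∈ J := by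
  by_contra hs
  rw [h.2 J hIJ hs] at hz
  exact hzI hz

/-- every element outside `I` has a multiple congruent to `s`. -/
theorem Good.exists_mul {I : Ideal A} {s : A} (h : Good I s) {z : A} (hzI : z ∉ I) :
    ∃ y, s - y * z ∈ I := by
  have : s ∈ I ⊔ Ideal.span {z} := h.mem_of_lt le_sup_left
    (Ideal.mem_sup_right (Ideal.mem_span_singleton_self z)) hzI
  obtain ⟨i, hi, w, hw, hs⟩ := Submodule.mem_sup.mp this
  obtain ⟨y, rfl⟩ := Ideal.mem_span_singleton'.mp hw
  exact ⟨y, by rw [← hs]; simpa using hi⟩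

theorem Good.mul_mem [IsLocalRing A] {I : Ideal A} {s : A} (h : Good I s) {y : A}
    (hy : y ∈ maximalIdeal A) : y * s ∈ I := by
  by_contra hn
  obtain ⟨c, hc⟩ := h.exists_mul hn
  have hu : IsUnit (1 - c * y) := by
    have : c * y ∈ maximalIdeal A := Ideal.mul_mem_left _ _ hy
    by_contra hnu
    have h1 : (1 - c * y) ∈ maximalIdeal A := (mem_maximalIdeal _).mpr hnu
    have := Ideal.add_mem _ h1 this
    rw [sub_add_cancel] at this
    exact (Ideal.ne_top_iff_one _).mp (maximalIdeal.isMaximal A).ne_top this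
  have : (1 - c * y) * s ∈ I := by convert hc using 1; ring
  exact h.1 ((Ideal.unit_mul_mem_iff_mem I hu).mp this)

theorem iInf_sup_pow [IsNoetherianRing A] [IsLocalRing A] (I : Ideal A) {z : A}
    (hz : ∀ n : ℕ, z ∈ I ⊔ maximalIdeal A ^ n) : z ∈ I := by
  have := Ideal.iInf_pow_smul_eq_bot_of_isLocalRing (M := A ⧸ I) (maximalIdeal A)
    (maximalIdeal.isMaximal A).ne_top
  rw [← Ideal.Quotient.eq_zero_iff_mem, ← Submodule.mem_bot A, ← this, Submodule.mem_iInf]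
  intro n
  obtain ⟨i, hi, w, hw, rfl⟩ := Submodule.mem_sup.mp (hz n)
  have h1 : (Ideal.Quotient.mk I) (i + w) = w • (1 : A ⧸ I) := by
    rw [map_add, Ideal.Quotient.eq_zero_iff_mem.mpr hi, zero_add, Algebra.smul_def, mul_one]
    rfl
  rw [h1]
  exact Submodule.smul_mem_smul hw trivial

theorem Good.pow_le [IsNoetherianRing A] [IsLocalRing A] {I : Ideal A} {s : A} (h : Good I s) :
    ∃ N : ℕ, maximalIdeal A ^ N ≤ I := by
  by_contra! hn
  apply h.1
  apply iInf_sup_pow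
  intro n
  obtain ⟨z, hz, hzI⟩ := Set.not_subset.mp (hn n)
  exact h.mem_of_lt le_sup_left (Ideal.mem_sup_right hz) hzI

theorem glue [IsNoetherianRing A] [IsLocalRing A] {I₁ I₂ P : Ideal A} {s₁ s₂ : A}
    (h₁ : Good I₁ s₁) (h₂ : Good I₂ s₂) (f g : A)
    (hsyz : ∀ a b, a * f + b * g ∈ P → a ∈ I₁ ∧ b ∈ I₂) :
    ∃ I s, Good I s ∧ P ≤ I ∧ I ≤ I₁ ∧ I ≤ I₂ := by
  have key : s₁ * f ∉ P ⊔ (I₁ * Ideal.span {f} ⊔ (I₂ * Ideal.span {g} ⊔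
      Ideal.span {s₁ * f - s₂ * g})) := by
    intro hmem
    obtain ⟨w, hw, k, hk, hs⟩ := Submodule.mem_sup.mp hmem
    obtain ⟨u, hu, v', hv', rfl⟩ := Submodule.mem_sup.mp hk
    obtain ⟨v, hv, x, hx, rfl⟩ := Submodule.mem_sup.mp hv'
    obtain ⟨a, ha, rfl⟩ := Ideal.mem_mul_span_singleton.mp hu
    obtain ⟨b, hb, rfl⟩ := Ideal.mem_mul_span_singleton.mp hv
    obtain ⟨c, rfl⟩ := Ideal.mem_span_singleton'.mp hx
    have h3 : (s₁ - a - c * s₁) * f + (c * s₂ - b) * g ∈ P := by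
      have : (s₁ - a - c * s₁) * f + (c * s₂ - b) * g = w := by linear_combination -hs
      rwa [this]
    obtain ⟨ha', hb'⟩ := hsyz _ _ h3
    have hcs : c * s₂ ∈ I₂ := by simpa using Ideal.add_mem _ hb' hb
    have hcs1 : (1 - c) * s₁ ∈ I₁ := by
      have := Ideal.add_mem _ ha' ha
      convert this using 1; ring
    rcases isUnit_or_isUnit_of_isUnit_add (a := c) (b := 1 - c) (by simp) with hc | hc
    · exact h₂.1 ((Ideal.unit_mul_mem_iff_mem _ hc).mp hcs)
    · exact h₁.1 ((Ideal.unit_mul_mem_iff_mem _ hc).mp hcs1)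
  obtain ⟨I, hKI, hI⟩ := exists_good _ _ key
  have hP : P ≤ I := le_sup_left.trans hKI
  have hf : I₁ * Ideal.span {f} ≤ I := le_sup_left.trans (le_sup_right.trans hKI)
  have hg : I₂ * Ideal.span {g} ≤ I :=
    le_sup_left.trans (le_sup_right.trans (le_sup_right.trans hKI))
  have hfg : s₁ * f - s₂ * g ∈ I :=
    (le_sup_right.trans (le_sup_right.trans (le_sup_right.trans hKI)))
      (Ideal.mem_span_singleton_self _)
  refine ⟨I, _, hI, hP, ?_, ?_⟩
  · have e : Submodule.colon I {f} = I₁ := by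
      apply h₁.2
      · intro x hx
        rw [Submodule.mem_colon_singleton]
        exact hf (Ideal.mul_mem_mul hx (Ideal.mem_span_singleton_self f))
      · rw [Submodule.mem_colon_singleton]; exact hI.1
    rw [← e]
    intro x hx
    rw [Submodule.mem_colon_singleton]
    exact Ideal.mul_mem_right _ _ hx
  · have e : Submodule.colon I {g} = I₂ := by
      apply h₂.2
      · intro x hx
        rw [Submodule.mem_colon_singleton]
        exact hg (Ideal.mul_mem_mul hx (Ideal.mem_span_singleton_self g))
      · rw [Submodule.mem_colon_singleton]
        intro h
        apply hI.1
        have := Ideal.add_mem _ hfg h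
        simpa using this
    rw [← e]
    intro x hx
    rw [Submodule.mem_colon_singleton]
    exact Ideal.mul_mem_right _ _ hx

theorem artinian_quot [IsNoetherianRing A] [IsLocalRing A] (J : Ideal A)
    (hJ : ∀ P : Ideal A, P.IsPrime → J ≤ P → P = maximalIdeal A) : IsArtinian A (A ⧸ J) := by
  have : Ring.KrullDimLE 0 (A ⧸ J) := by
    refine Ring.krullDimLE_zero_iff.mpr fun Q hQ => ?_
    have hP := hJ (Q.comap (Ideal.Quotient.mk J)) inferInstance (by
      intro x hx
      rw [Ideal.mem_comap, Ideal.Quotient.eq_zero_iff_mem.mpr hx]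
      exact Q.zero_mem)
    rw [← Ideal.map_comap_of_surjective _ Ideal.Quotient.mk_surjective Q, hP]
    have hmax : (maximalIdeal A).IsMaximal := inferInstance
    refine (Ideal.map_eq_top_or_isMaximal_of_surjective _ Ideal.Quotient.mk_surjective
      hmax).resolve_left ?_
    intro h
    rw [← hP, Ideal.map_comap_of_surjective _ Ideal.Quotient.mk_surjective Q] at h
    exact hQ.ne_top h
  have : IsArtinianRing (A ⧸ J) := IsNoetherianRing.isArtinianRing_of_krullDimLE_zero
  exact isArtinian_of_surjective_algebraMap (R := A ⧸ J) (S := A) Ideal.Quotient.mk_surjective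

theorem artinian_quot_pow [IsNoetherianRing A] [IsLocalRing A] (J : Ideal A) (n : ℕ)
    (hJ : maximalIdeal A ^ n ≤ J) : IsArtinian A (A ⧸ J) := by
  apply artinian_quot
  intro P hP hJP
  exact ((maximalIdeal.isMaximal A).eq_of_le hP.ne_top (hP.le_of_pow_le (hJ.trans hJP))).symm

/-- Directedness of good ideals implies that there are arbitrarily small ones. -/
theorem small_of_directed [IsNoetherianRing A] [IsLocalRing A]
    (hdir : ∀ (I₁ I₂ : Ideal A) (s₁ s₂ : A), Good I₁ s₁ → Good I₂ s₂ →
      ∃ I s, Good I s ∧ I ≤ I₁ ∧ I ≤ I₂) (n : ℕ) :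
    ∃ (I : Ideal A) (s : A), Good I s ∧ I ≤ maximalIdeal A ^ n := by
  have := artinian_quot_pow (maximalIdeal A ^ n) n le_rfl
  obtain ⟨I₀, -, hI₀⟩ := exists_good (maximalIdeal A) 1
    ((Ideal.ne_top_iff_one _).mp (maximalIdeal.isMaximal A).ne_top)
  obtain ⟨M, ⟨I, s, hI, rfl⟩, hmin⟩ := IsArtinian.set_has_minimal (R := A)
    {M : Submodule A (A ⧸ (maximalIdeal A ^ n)) | ∃ (I : Ideal A) (s : A), Good I s ∧
      M = Submodule.map (Submodule.mkQ (maximalIdeal A ^ n)) I} ⟨_, I₀, 1, hI₀, rfl⟩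
  refine ⟨I, s, hI, ?_⟩
  by_contra hn
  obtain ⟨z, hzI, hz⟩ := Set.not_subset.mp hn
  obtain ⟨I', hmI', hI'⟩ := exists_good (maximalIdeal A ^ n) z hz
  obtain ⟨I₃, s₃, hI₃, h31, h32⟩ := hdir I I' s z hI hI'
  refine hmin _ ⟨I₃, s₃, hI₃, rfl⟩ ?_
  refine lt_of_le_of_ne (Submodule.map_mono h31) ?_
  intro heq
  have h := congrArg (Submodule.comap (Submodule.mkQ (maximalIdeal A ^ n))) heq
  rw [Submodule.comap_map_mkQ, Submodule.comap_map_mkQ] at h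
  have hz3 : z ∈ maximalIdeal A ^ n ⊔ I₃ := by rw [h]; exact Ideal.mem_sup_right hzI
  exact hI'.1 ((sup_le hmI' h32) hz3)

theorem stabilizes [IsNoetherianRing A] [IsLocalRing A] (V : ℕ → Ideal A) (hV : Antitone V)
    (n : ℕ) : ∃ k, ∀ j, V k ⊔ maximalIdeal A ^ n ≤ V j ⊔ maximalIdeal A ^ n := by
  have := artinian_quot_pow (maximalIdeal A ^ n) n le_rfl
  obtain ⟨k, hk⟩ := IsArtinian.monotone_stabilizes (R := A) (M := A ⧸ (maximalIdeal A ^ n))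
    ⟨fun k => OrderDual.toDual (Submodule.map (Submodule.mkQ (maximalIdeal A ^ n)) (V k)),
      fun i j hij => Submodule.map_mono (hV hij)⟩
  refine ⟨k, fun j => ?_⟩
  rcases le_total k j with h | h
  · have h1 : Submodule.map (Submodule.mkQ (maximalIdeal A ^ n)) (V k) =
      Submodule.map (Submodule.mkQ (maximalIdeal A ^ n)) (V j) := hk j h
    have h := congrArg (Submodule.comap (Submodule.mkQ (maximalIdeal A ^ n))) h1
    rw [Submodule.comap_map_mkQ, Submodule.comap_map_mkQ] at h
    rw [sup_comm, h, sup_comm]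
  · exact sup_le_sup_right (hV h) _

/-- Chevalley's theorem. -/
theorem chevalley [IsNoetherianRing A] [IsLocalRing A] [IsAdicComplete (maximalIdeal A) A]
    (V : ℕ → Ideal A) (hV : Antitone V) (n : ℕ) :
    ∃ k, V k ≤ (⨅ j, V j) ⊔ maximalIdeal A ^ n := by
  choose κ hκ using stabilizes V hV
  refine ⟨κ n, fun z₀ hz₀ => ?_⟩
  have step : ∀ (N : ℕ) (z : A), (∀ j, z ∈ V j ⊔ maximalIdeal A ^ N) →
      ∃ z', (∀ j, z' ∈ V j ⊔ maximalIdeal A ^ (N + 1)) ∧ z - z' ∈ maximalIdeal A ^ N := by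
    intro N z hz
    obtain ⟨v, hv, y, hy, rfl⟩ := Submodule.mem_sup.mp (hz (κ (N + 1)))
    exact ⟨v, fun j => hκ (N + 1) j (Ideal.mem_sup_left hv), by simpa using hy⟩
  choose! nxt hn1 hn2 using step
  let f : ℕ → A := fun j => Nat.rec z₀ (fun i z => nxt (n + i) z) j
  have hf : ∀ i, ∀ j, f i ∈ V j ⊔ maximalIdeal A ^ (n + i) := by
    intro i
    induction i with
    | zero => exact fun j => hκ n j (Ideal.mem_sup_left hz₀)
    | succ i ih => exact hn1 (n + i) (f i) ih
  have hd : ∀ i, f i - f (i + 1) ∈ maximalIdeal A ^ (n + i) := fun i => hn2 (n + i) (f i) (hf i)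
  have hd' : ∀ i k, f i - f (i + k) ∈ maximalIdeal A ^ (n + i) := by
    intro i k
    induction k with
    | zero => simp
    | succ k ih =>
      have := Ideal.add_mem _ ih (Ideal.pow_le_pow_right (by omega) (hd (i + k)))
      simpa [add_assoc] using this
  obtain ⟨L, hL⟩ := IsPrecomplete.prec (I := maximalIdeal A) (M := A) inferInstance (f := f) (by
    intro i j hij
    obtain ⟨k, rfl⟩ := Nat.exists_eq_add_of_le hij
    rw [SModEq.sub_mem, smul_eq_mul, Ideal.mul_top]
    exact Ideal.pow_le_pow_right (by omega) (hd' i k))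
  have hL' : ∀ i, f i - L ∈ maximalIdeal A ^ i := by
    intro i
    have := hL i
    rwa [SModEq.sub_mem, smul_eq_mul, Ideal.mul_top] at this
  have hLV : L ∈ ⨅ j, V j := by
    rw [Submodule.mem_iInf]
    intro j
    apply iInf_sup_pow
    intro N
    have h1 : f N ∈ V j ⊔ maximalIdeal A ^ N :=
      (sup_le_sup_left (Ideal.pow_le_pow_right (Nat.le_add_left N n)) (V j) :
        V j ⊔ maximalIdeal A ^ (n + N) ≤ _) (hf N j)
    have := Ideal.sub_mem _ h1 (Ideal.mem_sup_right (S := V j) (hL' N))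
    simpa using this
  have h0 : z₀ - L ∈ maximalIdeal A ^ n := by
    have := Ideal.add_mem _ (hd' 0 n) (by simpa using hL' n)
    simpa [f] using this
  have := Ideal.add_mem _ (Ideal.mem_sup_left hLV) (Ideal.mem_sup_right (S := ⨅ j, V j) h0)
  simpa using this

end Basic
theorem krull_loc {A : Type*} [CommRing A] [IsDomain A] [IsNoetherianRing A] (P : Ideal A)
    [P.IsPrime] (f y z : A) (hf : f ∈ P) (hy : y ∉ P)
    (h : ∀ N : ℕ, ∃ k : ℕ, f ^ N ∣ y ^ k * z) : z = 0 := by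
  let B := Localization.AtPrime P
  have hinj : Function.Injective (algebraMap A B) :=
    IsLocalization.injective B P.primeCompl_le_nonZeroDivisors
  apply hinj
  rw [map_zero, ← Ideal.mem_bot,
    ← Ideal.iInf_pow_eq_bot_of_isLocalRing _ (maximalIdeal.isMaximal B).ne_top,
    Submodule.mem_iInf]
  intro N
  obtain ⟨k, c, hc⟩ := h N
  have hu : IsUnit (algebraMap A B (y ^ k)) :=
    IsLocalization.map_units B (⟨y ^ k, fun hk => hy (Ideal.IsPrime.mem_of_pow_mem ‹_› k hk)⟩ :
      P.primeCompl)
  rw [← Ideal.unit_mul_mem_iff_mem _ hu, ← map_mul, hc, map_mul, map_pow]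
  refine Ideal.mul_mem_right _ _ (Ideal.pow_mem_pow ?_ N)
  exact (IsLocalization.AtPrime.to_map_mem_maximal_iff B P f).mpr hf

section Dim2
variable {A : Type*} [CommRing A] [IsNoetherianRing A] [IsLocalRing A]
  [IsAdicComplete (maximalIdeal A) A]

theorem chevalley_bot (V : ℕ → Ideal A) (hV : Antitone V) (h0 : ∀ z, (∀ j, z ∈ V j) → z = 0)
    (n : ℕ) : ∃ k, V k ≤ maximalIdeal A ^ n := by
  obtain ⟨k, hk⟩ := chevalley V hV n
  have : ⨅ j, V j = ⊥ := by
    rw [eq_bot_iff]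
    intro z hz
    exact h0 z (fun j => (Submodule.mem_iInf _).mp hz j)
  rw [this, bot_sup_eq] at hk
  exact ⟨k, hk⟩

theorem dim_ge_two [IsDomain A] (P : Ideal A) [P.IsPrime] (hP0 : P ≠ ⊥) (hPm : P ≠ maximalIdeal A) (n : ℕ) :
    ∃ (I : Ideal A) (s : A), Good I s ∧ I ≤ maximalIdeal A ^ n := by
  obtain ⟨f₀, hf₀, hf0⟩ := Submodule.exists_mem_ne_zero_of_ne_bot hP0
  have hlt : ¬ maximalIdeal A ≤ P := fun h =>
    hPm (le_antisymm (le_maximalIdeal (Ideal.IsPrime.ne_top inferInstance)) h)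
  obtain ⟨y, hym, hyP⟩ := Set.not_subset.mp hlt
  refine small_of_directed (fun I₁ I₂ s₁ s₂ h₁ h₂ => ?_) n
  obtain ⟨n₁, hn₁⟩ := h₁.pow_le
  obtain ⟨n₂, hn₂⟩ := h₂.pow_le
  -- first choose the power of `f₀`
  let V : ℕ → Ideal A := fun N =>
    { carrier := {z | ∃ k : ℕ, f₀ ^ N ∣ y ^ k * z}
      zero_mem' := ⟨0, by simp⟩
      add_mem' := by
        rintro a b ⟨k, hk⟩ ⟨l, hl⟩
        refine ⟨k + l, ?_⟩
        have : y ^ (k + l) * (a + b) = y ^ l * (y ^ k * a) + y ^ k * (y ^ l * b) := by ring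
        rw [this]
        exact dvd_add (hk.mul_left _) (hl.mul_left _)
      smul_mem' := by
        rintro c a ⟨k, hk⟩
        refine ⟨k, ?_⟩
        have : y ^ k * (c • a) = c * (y ^ k * a) := by simp only [smul_eq_mul]; ring
        rw [this]
        exact hk.mul_left _ }
  have hV : Antitone V := by
    rintro i j hij z ⟨k, hk⟩
    exact ⟨k, (pow_dvd_pow f₀ hij).trans hk⟩
  obtain ⟨N, hN⟩ := chevalley_bot V hV (fun z hz => krull_loc P f₀ y z hf₀ hyP hz) n₂
  have hf0N : f₀ ^ N ≠ 0 := pow_ne_zero _ hf0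
  let W : ℕ → Ideal A := fun M => Submodule.colon (Ideal.span {y ^ M}) {f₀ ^ N}
  have hW : Antitone W := by
    intro i j hij
    refine Submodule.colon_mono ?_ le_rfl
    rw [Ideal.span_singleton_le_span_singleton]
    exact pow_dvd_pow y hij
  obtain ⟨M, hM⟩ := chevalley_bot W hW (fun z hz => by
    have h1 : ∀ j : ℕ, z * f₀ ^ N ∈ (maximalIdeal A) ^ j := by
      intro j
      have := hz j
      rw [Submodule.mem_colon_singleton, smul_eq_mul, Ideal.mem_span_singleton'] at this
      obtain ⟨c, hc⟩ := this
      rw [← hc]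
      exact Ideal.mul_mem_left _ _ (Ideal.pow_mem_pow hym j)
    have h2 : z * f₀ ^ N ∈ ⨅ j : ℕ, (maximalIdeal A) ^ j := by
      rw [Submodule.mem_iInf]; exact h1
    rw [Ideal.iInf_pow_eq_bot_of_isLocalRing _ (maximalIdeal.isMaximal A).ne_top,
      Ideal.mem_bot] at h2
    exact (mul_eq_zero.mp h2).resolve_right hf0N) n₁
  obtain ⟨I, s, hI, -, hI1, hI2⟩ := glue (P := ⊥) h₁ h₂ (f₀ ^ N) (y ^ M) (by
    intro a b hab
    rw [Ideal.mem_bot] at hab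
    constructor
    · apply hn₁; apply hM
      rw [Submodule.mem_colon_singleton, smul_eq_mul, Ideal.mem_span_singleton']
      exact ⟨-b, by linear_combination -hab⟩
    · apply hn₂; apply hN
      exact ⟨M, -a, by linear_combination hab⟩)
  exact ⟨I, s, hI, hI1, hI2⟩
end Dim2
section Dim1
open Polynomial

/-- a polynomial with a unit coefficient: a root or its inverse is integral -/
theorem integral_or_inv {A K : Type*} [CommRing A] [IsDomain A] [IsLocalRing A]
    [IsAdicComplete (maximalIdeal A) A] [Field K] [Algebra A K] [IsFractionRing A K]
    (F : A[X]) (j : ℕ) (hj : IsUnit (F.coeff j)) (a : K) (ha : aeval a F = 0) :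
    IsIntegral A a ∨ IsIntegral A a⁻¹ := by
  have hne : (F : PowerSeries A).map (IsLocalRing.residue A) ≠ 0 := by
    intro h
    have h1 := congrArg (PowerSeries.coeff j) h
    rw [PowerSeries.coeff_map, Polynomial.coeff_coe, map_zero] at h1
    exact (hj.map (IsLocalRing.residue A)).ne_zero h1
  obtain ⟨g, h, H⟩ := PowerSeries.exists_isWeierstrassFactorization hne
  have hdvd : g ∣ F := by
    rw [← Ideal.mem_span_singleton, ← Ideal.Quotient.eq_zero_iff_mem]
    apply H.isDistinguishedAt.algEquivQuotient.injective
    rw [map_zero]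
    have : H.isDistinguishedAt.algEquivQuotient (Ideal.Quotient.mk _ F) =
      Ideal.Quotient.mk _ (F : PowerSeries A) := by simp
    rw [this, Ideal.Quotient.eq_zero_iff_mem, Ideal.mem_span_singleton]
    exact ⟨h, H.eq_mul⟩
  obtain ⟨h', rfl⟩ := hdvd
  have hg0 : (g : PowerSeries A) ≠ 0 := by
    intro h0
    exact H.isDistinguishedAt.monic.ne_zero (Polynomial.coe_eq_zero_iff.mp h0)
  have hh : (h' : PowerSeries A) = h := by
    have := H.eq_mul
    rw [Polynomial.coe_mul] at this
    exact mul_left_cancel₀ hg0 this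
  have hu : IsUnit (h'.coeff 0) := by
    have := PowerSeries.isUnit_iff_constantCoeff.mp (hh ▸ H.isUnit)
    simpa using this
  rw [map_mul, mul_eq_zero] at ha
  rcases ha with ha | ha
  · left
    exact ⟨g, H.isDistinguishedAt.monic, ha⟩
  · right
    by_cases ha0 : a = 0
    · rw [ha0, inv_zero]; exact isIntegral_zero
    have h1 : eval₂ (algebraMap A K) a⁻¹ h'.reverse = 0 := by
      have : Invertible a := invertibleOfNonzero ha0
      have h2 := (Polynomial.eval₂_reverse_eq_zero_iff (algebraMap A K) a h').mpr ha
      rwa [invOf_eq_inv] at h2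
    have h3 : h'.reverse.leadingCoeff = h'.coeff 0 := by
      rw [reverse_leadingCoeff, trailingCoeff, natTrailingDegree_eq_zero.mpr (Or.inr hu.ne_zero)]
    obtain ⟨c, hc⟩ := hu.exists_left_inv
    refine ⟨C c * h'.reverse, ?_, by rw [eval₂_mul, h1, mul_zero]⟩
    have : (C c * h'.reverse).leadingCoeff = 1 := by
      rw [leadingCoeff_mul, h3, leadingCoeff_C, hc]
    exact this

/-- length of the quotient -/
noncomputable def ell {A : Type*} [CommRing A] (J : Ideal A) : ℕ∞ := Module.length A (A ⧸ J)

section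
variable {A : Type*} [CommRing A]

theorem ell_anti {J J' : Ideal A} (h : J ≤ J') : ell J' ≤ ell J :=
  Module.length_le_of_surjective (Submodule.factor h) (Submodule.factor_surjective h)

theorem ell_strict {J J' : Ideal A} (h : J < J') : ell J' + 1 ≤ ell J := by
  have h1 : ell J = Module.length A (LinearMap.ker (Submodule.factor h.le)) + ell J' :=
    Module.length_eq_add_of_exact (LinearMap.ker (Submodule.factor h.le)).subtype
      (Submodule.factor h.le) (Submodule.subtype_injective _) (Submodule.factor_surjective h.le)
      (LinearMap.exact_subtype_ker_map _)
  rw [h1, add_comm]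
  gcongr
  rw [Order.one_le_iff_pos, Module.length_pos_iff, Submodule.nontrivial_iff_ne_bot]
  obtain ⟨z, hz, hzJ⟩ := Set.exists_of_ssubset h
  rw [Submodule.ne_bot_iff]
  refine ⟨Submodule.Quotient.mk z, ?_, ?_⟩
  · rw [LinearMap.mem_ker]
    exact (Submodule.Quotient.mk_eq_zero J').mpr hz
  · intro h0
    exact hzJ ((Submodule.Quotient.mk_eq_zero J).mp h0)

theorem ell_mul [IsDomain A] (M : Ideal A) (s : A) (hs : s ≠ 0) :
    ell (Ideal.span {s} * M) = ell M + ell (Ideal.span {s}) := by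
  have hle : Ideal.span {s} * M ≤ Ideal.span {s} := Ideal.mul_le_left
  let φ : (A ⧸ M) →ₗ[A] (A ⧸ (Ideal.span {s} * M)) :=
    Submodule.mapQ M (Ideal.span {s} * M) (LinearMap.mulLeft A s) (by
      intro x hx
      exact Ideal.mul_mem_mul (Ideal.mem_span_singleton_self s) hx)
  refine Module.length_eq_add_of_exact φ (Submodule.factor hle) ?_
    (Submodule.factor_surjective hle) ?_
  · rw [← LinearMap.ker_eq_bot, LinearMap.ker_eq_bot']
    intro x hx
    obtain ⟨x, rfl⟩ := Submodule.Quotient.mk_surjective _ x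
    have h1 : s * x ∈ Ideal.span {s} * M := (Submodule.Quotient.mk_eq_zero _).mp hx
    obtain ⟨z, hz, hzx⟩ := Ideal.mem_span_singleton_mul.mp h1
    rw [Submodule.Quotient.mk_eq_zero, ← mul_left_cancel₀ hs hzx]
    exact hz
  · intro x
    obtain ⟨x, rfl⟩ := Submodule.Quotient.mk_surjective _ x
    constructor
    · intro hx
      have h1 : x ∈ Ideal.span {s} := (Submodule.Quotient.mk_eq_zero _).mp hx
      obtain ⟨c, rfl⟩ := Ideal.mem_span_singleton.mp h1
      exact ⟨Submodule.Quotient.mk c, rfl⟩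
    · rintro ⟨c, hc⟩
      obtain ⟨c, rfl⟩ := Submodule.Quotient.mk_surjective _ c
      rw [← hc]
      refine (Submodule.Quotient.mk_eq_zero (Ideal.span {s})).mpr ?_
      exact Ideal.mul_mem_right _ _ (Ideal.mem_span_singleton_self s)

theorem exists_ideal_of_integral [IsDomain A] {K : Type*} [Field K] [Algebra A K]
    [IsFractionRing A K] (r s : A) (hs : s ≠ 0)
    (h : IsIntegral A (algebraMap A K r / algebraMap A K s)) :
    ∃ M : Ideal A, M ≠ ⊥ ∧ ∀ y ∈ M, ∃ w ∈ M, r * y = s * w := by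
  set a := algebraMap A K r / algebraMap A K s with ha
  obtain ⟨d, hd, hdint⟩ := FractionalIdeal.isFractional_of_fg (S := nonZeroDivisors A)
    h.fg_adjoin_singleton
  have hinj : Function.Injective (algebraMap A K) := IsFractionRing.injective A K
  have hsK : algebraMap A K s ≠ 0 := by
    rw [Ne, map_eq_zero_iff _ hinj]; exact hs
  have hsa : algebraMap A K s * a = algebraMap A K r := by rw [ha]; field_simp
  let M : Ideal A :=
    { carrier := {y | ∃ u ∈ Algebra.adjoin A {a}, algebraMap A K y = d • u}
      zero_mem' := ⟨0, Subalgebra.zero_mem _, by simp⟩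
      add_mem' := by
        rintro x y ⟨u, hu, hx⟩ ⟨v, hv, hy⟩
        exact ⟨u + v, Subalgebra.add_mem _ hu hv, by rw [map_add, hx, hy, smul_add]⟩
      smul_mem' := by
        rintro c y ⟨u, hu, hy⟩
        refine ⟨c • u, Subalgebra.smul_mem _ hu c, ?_⟩
        rw [smul_eq_mul, map_mul, hy, smul_comm d c u, Algebra.smul_def c] }
  refine ⟨M, ?_, ?_⟩
  · rw [Submodule.ne_bot_iff]
    refine ⟨d, ⟨1, Subalgebra.one_mem _, by rw [Algebra.smul_def, mul_one]⟩,
      nonZeroDivisors.ne_zero hd⟩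
  · rintro y ⟨u, hu, hy⟩
    have hau : a * u ∈ Algebra.adjoin A {a} :=
      Subalgebra.mul_mem _ (Algebra.self_mem_adjoin_singleton A a) hu
    obtain ⟨w, hw⟩ := hdint (a * u) hau
    refine ⟨w, ⟨a * u, hau, hw⟩, ?_⟩
    apply hinj
    rw [map_mul, map_mul, hw, hy, ← hsa, Algebra.smul_def, Algebra.smul_def]
    ring

theorem ell_le_of_ideal [IsDomain A]
    (hfin : ∀ M : Ideal A, M ≠ ⊥ → ell M ≠ ⊤) (r s : A) (hr : r ≠ 0) (hs : s ≠ 0)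
    (M : Ideal A) (hM : M ≠ ⊥) (h : ∀ y ∈ M, ∃ w ∈ M, r * y = s * w) :
    ell (Ideal.span {s}) ≤ ell (Ideal.span {r}) := by
  have h1 : Ideal.span {r} * M ≤ Ideal.span {s} * M := by
    intro z hz
    obtain ⟨y, hy, rfl⟩ := Ideal.mem_span_singleton_mul.mp hz
    obtain ⟨w, hw, hrw⟩ := h y hy
    rw [hrw]
    exact Ideal.mul_mem_mul (Ideal.mem_span_singleton_self s) hw
  have h2 := ell_anti h1
  rw [ell_mul M r hr, ell_mul M s hs] at h2
  exact (ENat.add_le_add_iff_left (hfin M hM)).mp h2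

theorem isUnit_one_sub [IsLocalRing A] {c : A} (hc : c ∈ maximalIdeal A) : IsUnit (1 - c) := by
  rcases isUnit_or_isUnit_of_isUnit_add (a := c) (b := 1 - c) (by simp) with h | h
  · exact absurd h ((mem_maximalIdeal c).mp hc)
  · exact h

/-- combinations of `g` whose coefficients from index `k` on lie in the maximal ideal -/
def relIdeal [IsLocalRing A] {N : ℕ} (g : Fin N → A) (k : ℕ) : Ideal A where
  carrier := {z | ∃ c : Fin N → A, (∀ i : Fin N, k ≤ i → c i ∈ maximalIdeal A) ∧
    ∑ i, c i * g i = z}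
  zero_mem' := ⟨0, by simp, by simp⟩
  add_mem' := by
    rintro a b ⟨c, hc, rfl⟩ ⟨d, hd, rfl⟩
    refine ⟨c + d, fun i hi => Ideal.add_mem _ (hc i hi) (hd i hi), ?_⟩
    rw [← Finset.sum_add_distrib]
    exact Finset.sum_congr rfl fun i _ => by simp [add_mul]
  smul_mem' := by
    rintro a b ⟨c, hc, rfl⟩
    refine ⟨a • c, fun i hi => Ideal.mul_mem_left _ _ (hc i hi), ?_⟩
    rw [smul_eq_mul, Finset.mul_sum]
    exact Finset.sum_congr rfl fun i _ => by simp [mul_assoc]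

theorem single_mem_relIdeal [IsLocalRing A] {N : ℕ} (g : Fin N → A) (i : Fin N) (k : ℕ)
    (hk : (i : ℕ) < k) : g i ∈ relIdeal g k := by
  classical
  refine ⟨Pi.single i 1, fun l hl => ?_, ?_⟩
  · have : l ≠ i := by rintro rfl; omega
    simp [this]
  · simp [Pi.single_apply]

theorem relIdeal_mono [IsLocalRing A] {N : ℕ} (g : Fin N → A) {k l : ℕ} (h : k ≤ l) :
    relIdeal g k ≤ relIdeal g l := by
  rintro z ⟨c, hc, rfl⟩
  exact ⟨c, fun i hi => hc i (h.trans hi), rfl⟩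

/-- In the one-dimensional case there is a homogeneous relation with a unit coefficient. -/
theorem exists_relation [IsDomain A] [IsLocalRing A]
    (hfin : ∀ M : Ideal A, M ≠ ⊥ → ell M ≠ ⊤) (x : A) (hx : x ∈ maximalIdeal A) (hx0 : x ≠ 0)
    (r s : A) (hr : r ≠ 0) :
    ∃ (n : ℕ) (c : Fin (n + 1) → A) (j : Fin (n + 1)), IsUnit (c j) ∧
      ∑ i, c i * (r ^ (i : ℕ) * s ^ (n - i)) = 0 := by
  classical
  obtain ⟨n, hn⟩ := ENat.ne_top_iff_exists.mp (hfin (Ideal.span {x}) (by simpa using hx0))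
  let g : Fin (n + 1) → A := fun i => r ^ (i : ℕ) * s ^ (n - i)
  by_contra! hno
  have hstep : ∀ k : Fin (n + 1), relIdeal g k < relIdeal g (k + 1) := by
    intro k
    refine lt_of_le_of_ne (relIdeal_mono g (Nat.le_succ _)) ?_
    intro heq
    have hk : g k ∈ relIdeal g k := by
      rw [heq]; exact single_mem_relIdeal g k _ (Nat.lt_succ_self _)
    obtain ⟨c, hc, hcs⟩ := hk
    refine hno n (Pi.single k 1 - c) k ?_ ?_
    · simpa using isUnit_one_sub (hc k le_rfl)
    · have h2 : ∑ i, (Pi.single k 1 : Fin (n + 1) → A) i * g i = g k := by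
        simp [Pi.single_apply]
      have h3 : ∑ i, ((Pi.single k 1 : Fin (n + 1) → A) - c) i * g i = 0 := by
        simp only [Pi.sub_apply, sub_mul, Finset.sum_sub_distrib]
        rw [h2, hcs, sub_self]
      exact h3
  have hchain : ∀ k : ℕ, k ≤ n + 1 → ell (relIdeal g k) + k ≤ ell (relIdeal g 0) := by
    intro k
    induction k with
    | zero => simp
    | succ k ih =>
      intro hk
      have h1 := ell_strict (hstep ⟨k, by omega⟩)
      refine le_trans ?_ (ih (by omega))
      push_cast
      rw [add_comm (k : ℕ∞) 1, ← add_assoc]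
      gcongr
  set Q := relIdeal g (n + 1) with hQ
  have hQ0 : Q ≠ ⊥ := by
    rw [Submodule.ne_bot_iff]
    refine ⟨g (Fin.last n), single_mem_relIdeal g _ _ (by simp), ?_⟩
    simp [g, hr]
  have hxQ : Ideal.span {x} * Q ≤ relIdeal g 0 := by
    intro z hz
    obtain ⟨y, ⟨c, -, rfl⟩, rfl⟩ := Ideal.mem_span_singleton_mul.mp hz
    refine ⟨x • c, fun i _ => Ideal.mul_mem_right _ _ hx, ?_⟩
    rw [Finset.mul_sum]
    exact Finset.sum_congr rfl fun i _ => by simp [mul_assoc]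
  have h1 := (hchain (n + 1) le_rfl).trans (ell_anti hxQ)
  rw [ell_mul Q x hx0, ← hn, ENat.add_le_add_iff_left (hfin Q hQ0)] at h1
  have : n + 1 ≤ n := by exact_mod_cast h1
  omega

theorem ell_add [IsDomain A] [IsLocalRing A] [IsAdicComplete (maximalIdeal A) A]
    (hfin : ∀ M : Ideal A, M ≠ ⊥ → ell M ≠ ⊤) (x : A) (hx : x ∈ maximalIdeal A) (hx0 : x ≠ 0)
    (r s : A) (hr : r ≠ 0) (hs : s ≠ 0) (hrs : r + s ≠ 0) :
    min (ell (Ideal.span {r})) (ell (Ideal.span {s})) ≤ ell (Ideal.span {r + s}) := by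
  obtain ⟨n, c, j, hj, hrel⟩ := exists_relation hfin x hx hx0 r s hr
  let K := FractionRing A
  have hinj : Function.Injective (algebraMap A K) := IsFractionRing.injective A K
  have hsK : algebraMap A K s ≠ 0 := by
    rw [Ne, map_eq_zero_iff _ hinj]; exact hs
  let F : A[X] := ∑ i : Fin (n + 1), C (c i) * X ^ (i : ℕ)
  have hF : F.coeff j = c j := by
    simp only [F, finsetSum_coeff, coeff_C_mul, coeff_X_pow]
    rw [Finset.sum_eq_single j]
    · simp
    · intro b _ hb
      have : (j : ℕ) ≠ b := fun h => hb (Fin.ext h.symm)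
      simp [this]
    · simp
  have hroot : aeval (algebraMap A K r / algebraMap A K s) F = 0 := by
    have h1 : algebraMap A K s ^ n * aeval (algebraMap A K r / algebraMap A K s) F = 0 := by
      rw [← map_zero (algebraMap A K), ← hrel, map_sum, map_sum, Finset.mul_sum]
      refine Finset.sum_congr rfl fun i _ => ?_
      have hi : (i : ℕ) ≤ n := by omega
      rw [map_mul, map_pow, aeval_X, aeval_C, map_mul, map_mul, map_pow, map_pow, div_pow]
      have e : algebraMap A K s ^ n =
          algebraMap A K s ^ (n - (i : ℕ)) * algebraMap A K s ^ (i : ℕ) := by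
        rw [← pow_add, Nat.sub_add_cancel hi]
      rw [e]
      have e2 := div_mul_cancel₀ (algebraMap A K r ^ (i : ℕ)) (pow_ne_zero (i : ℕ) hsK)
      generalize algebraMap A K r ^ (i : ℕ) / algebraMap A K s ^ (i : ℕ) = w at e2 ⊢
      rw [← e2]
      ring
    exact (mul_eq_zero.mp h1).resolve_left (pow_ne_zero _ hsK)
  rcases integral_or_inv F j (hF ▸ hj) _ hroot with h | h
  · obtain ⟨M, hM, hM'⟩ := exists_ideal_of_integral r s hs h
    refine (min_le_right _ _).trans (ell_le_of_ideal hfin _ _ hrs hs M hM ?_)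
    intro y hy
    obtain ⟨w, hw, e⟩ := hM' y hy
    exact ⟨w + y, Ideal.add_mem _ hw hy, by linear_combination e⟩
  · rw [inv_div] at h
    obtain ⟨M, hM, hM'⟩ := exists_ideal_of_integral s r hr h
    refine (min_le_left _ _).trans (ell_le_of_ideal hfin _ _ hrs hr M hM ?_)
    intro y hy
    obtain ⟨w, hw, e⟩ := hM' y hy
    exact ⟨w + y, Ideal.add_mem _ hw hy, by linear_combination e⟩

theorem le_ell_of_pow_notMem [IsLocalRing A] (x r : A) (hx : x ∈ maximalIdeal A) (k : ℕ)
    (h : x ^ k ∉ Ideal.span {r}) : (k : ℕ∞) ≤ ell (Ideal.span {r}) := by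
  have hchain : ∀ i : ℕ, i ≤ k → (i : ℕ∞) ≤ ell (Ideal.span {r} ⊔ Ideal.span {x ^ i}) := by
    intro i
    induction i with
    | zero => simp
    | succ i ih =>
      intro hi
      have hle : Ideal.span {r} ⊔ Ideal.span {x ^ (i + 1)} ≤
          Ideal.span {r} ⊔ Ideal.span {x ^ i} := by
        refine sup_le_sup_left ?_ _
        rw [Ideal.span_singleton_le_span_singleton]
        exact pow_dvd_pow x (Nat.le_succ i)
      have hlt : Ideal.span {r} ⊔ Ideal.span {x ^ (i + 1)} <
          Ideal.span {r} ⊔ Ideal.span {x ^ i} := by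
        refine lt_of_le_of_ne hle ?_
        intro heq
        have h1 : x ^ i ∈ Ideal.span {r} ⊔ Ideal.span {x ^ (i + 1)} := by
          rw [heq]; exact Ideal.mem_sup_right (Ideal.mem_span_singleton_self _)
        obtain ⟨u, hu, v, hv, huv⟩ := Submodule.mem_sup.mp h1
        obtain ⟨b, rfl⟩ := Ideal.mem_span_singleton'.mp hv
        have h2 : (1 - b * x) * x ^ i ∈ Ideal.span {r} := by
          have : (1 - b * x) * x ^ i = u := by linear_combination -huv
          rwa [this]
        rw [Ideal.unit_mul_mem_iff_mem _ (isUnit_one_sub (Ideal.mul_mem_left _ _ hx))] at h2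
        apply h
        rw [← Nat.sub_add_cancel (Nat.le_of_succ_le hi), pow_add]
        exact Ideal.mul_mem_left _ _ h2
      refine le_trans ?_ (ell_strict hlt)
      push_cast
      gcongr
      exact ih (by omega)
  exact (hchain k le_rfl).trans (ell_anti le_sup_left)

theorem dim_one [IsDomain A] [IsNoetherianRing A] [IsLocalRing A]
    [IsAdicComplete (maximalIdeal A) A]
    (h1 : ∀ P : Ideal A, P.IsPrime → P ≠ ⊥ → P = maximalIdeal A)
    (hm : maximalIdeal A ≠ ⊥) (n : ℕ) :
    ∃ (I : Ideal A) (s : A), Good I s ∧ I ≤ maximalIdeal A ^ n := by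
  have hfin : ∀ M : Ideal A, M ≠ ⊥ → ell M ≠ ⊤ := by
    intro M hM
    have : IsArtinian A (A ⧸ M) := artinian_quot M fun P hP hMP => h1 P hP (by
      rintro rfl; exact hM (le_bot_iff.mp hMP))
    exact Module.length_ne_top
  obtain ⟨x, hx, hx0⟩ := Submodule.exists_mem_ne_zero_of_ne_bot hm
  let V : ℕ → Ideal A := fun k =>
    { carrier := {r | r = 0 ∨ (k : ℕ∞) ≤ ell (Ideal.span {r})}
      zero_mem' := Or.inl rfl
      add_mem' := by
        intro r s hr hs
        by_cases hr0 : r = 0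
        · rw [hr0, zero_add]; exact hs
        by_cases hs0 : s = 0
        · rw [hs0, add_zero]; exact hr
        by_cases hrs : r + s = 0
        · exact Or.inl hrs
        right
        exact (le_min (hr.resolve_left hr0) (hs.resolve_left hs0)).trans
          (ell_add hfin x hx hx0 r s hr0 hs0 hrs)
      smul_mem' := by
        intro c r hr
        rcases hr with hr | hr
        · left; rw [hr, smul_zero]
        · right
          refine hr.trans (ell_anti ?_)
          rw [Ideal.span_singleton_le_span_singleton]
          exact dvd_mul_left _ _ }
  have hV : Antitone V := by
    intro i j hij r hr
    rcases hr with hr | hr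
    · exact Or.inl hr
    · exact Or.inr (le_trans (by exact_mod_cast hij) hr)
  obtain ⟨k, hk⟩ := chevalley_bot V hV (fun z hz => by
    by_contra hz0
    obtain ⟨N, hN⟩ := ENat.ne_top_iff_exists.mp (hfin (Ideal.span {z}) (by simpa using hz0))
    have := (hz (N + 1)).resolve_left hz0
    rw [← hN] at this
    have : N + 1 ≤ N := by exact_mod_cast this
    omega) n
  obtain ⟨I, -, hI⟩ := exists_good (⊥ : Ideal A) (x ^ k) (by simpa using pow_ne_zero k hx0)
  refine ⟨I, _, hI, fun r hr => ?_⟩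
  apply hk
  right
  apply le_ell_of_pow_notMem x r hx
  intro hmem
  exact hI.1 ((Ideal.span_singleton_le_iff_mem I).mpr hr hmem)

theorem domain_case [IsDomain A] [IsNoetherianRing A] [IsLocalRing A]
    [IsAdicComplete (maximalIdeal A) A] (n : ℕ) :
    ∃ (I : Ideal A) (s : A), Good I s ∧ I ≤ maximalIdeal A ^ n := by
  by_cases hm : maximalIdeal A = ⊥
  · obtain ⟨I, -, hI⟩ := exists_good (⊥ : Ideal A) 1 (by simp)
    refine ⟨I, 1, hI, ?_⟩
    have : I ≤ maximalIdeal A := le_maximalIdeal ((Ideal.ne_top_iff_one I).mpr hI.1)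
    rw [hm] at this
    exact this.trans bot_le
  by_cases h : ∀ P : Ideal A, P.IsPrime → P ≠ ⊥ → P = maximalIdeal A
  · exact dim_one h hm n
  · push Not at h
    obtain ⟨P, hP, hP0, hPm⟩ := h
    exact dim_ge_two P hP0 hPm n

end

end Dim1
section Reduced
variable {A : Type*} [CommRing A]

theorem smodEq_pow {I : Ideal A} {n : ℕ} {x y : A} :
    x ≡ y [SMOD (I ^ n • ⊤ : Submodule A A)] ↔ x - y ∈ I ^ n := by
  rw [SModEq.sub_mem, smul_eq_mul, Ideal.mul_top]

theorem map_maximalIdeal_quot [IsLocalRing A] (P : Ideal A) [IsLocalRing (A ⧸ P)] :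
    (maximalIdeal A).map (Ideal.Quotient.mk P) = maximalIdeal (A ⧸ P) := by
  apply le_antisymm
  · rw [Ideal.map_le_iff_le_comap]
    have := Ideal.comap_isMaximal_of_surjective (Ideal.Quotient.mk P)
      Ideal.Quotient.mk_surjective (K := maximalIdeal (A ⧸ P))
    exact (IsLocalRing.eq_maximalIdeal this).ge
  · intro z hz
    obtain ⟨y, rfl⟩ := Ideal.Quotient.mk_surjective z
    apply Ideal.mem_map_of_mem
    rw [mem_maximalIdeal] at hz ⊢
    intro hu
    exact hz (hu.map _)

theorem complete_quot [IsNoetherianRing A] [IsLocalRing A] [IsAdicComplete (maximalIdeal A) A]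
    (P : Ideal A) [IsLocalRing (A ⧸ P)] : IsAdicComplete (maximalIdeal (A ⧸ P)) (A ⧸ P) := by
  have hpow : ∀ n, maximalIdeal (A ⧸ P) ^ n = (maximalIdeal A ^ n).map (Ideal.Quotient.mk P) := by
    intro n
    rw [Ideal.map_pow, map_maximalIdeal_quot]
  have : IsPrecomplete (maximalIdeal (A ⧸ P)) (A ⧸ P) := by
    refine ⟨fun f hf => ?_⟩
    have hd : ∀ i, ∃ d ∈ maximalIdeal A ^ i, Ideal.Quotient.mk P d = f (i + 1) - f i := by
      intro i
      have h1 := (smodEq_pow.mp (hf (Nat.le_succ i)).symm)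
      rw [hpow] at h1
      exact (Ideal.mem_map_iff_of_surjective _ Ideal.Quotient.mk_surjective).mp h1
    choose d hd hdf using hd
    obtain ⟨g0, hg0⟩ := Ideal.Quotient.mk_surjective (f 0)
    let g : ℕ → A := fun n => g0 + ∑ i ∈ Finset.range n, d i
    have hg : ∀ n, Ideal.Quotient.mk P (g n) = f n := by
      intro n
      induction n with
      | zero => simp [g, hg0]
      | succ n ih =>
        have : g (n + 1) = g n + d n := by simp [g, Finset.sum_range_succ, add_assoc]
        rw [this, map_add, ih, hdf]
        ring
    have hgc : ∀ {m n}, m ≤ n → g m ≡ g n [SMOD (maximalIdeal A ^ m • ⊤ : Submodule A A)] := by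
      intro m n hmn
      rw [smodEq_pow, ← neg_mem_iff, neg_sub]
      have : g n - g m = ∑ i ∈ Finset.Ico m n, d i := by
        simp [g, Finset.sum_Ico_eq_sub _ hmn]
      rw [this]
      exact Ideal.sum_mem _ fun i hi => Ideal.pow_le_pow_right (Finset.mem_Ico.mp hi).1 (hd i)
    obtain ⟨L, hL⟩ := IsPrecomplete.prec (inferInstance : IsPrecomplete (maximalIdeal A) A) hgc
    refine ⟨Ideal.Quotient.mk P L, fun n => ?_⟩
    rw [smodEq_pow, hpow, ← hg n, ← map_sub]
    exact Ideal.mem_map_of_mem _ (smodEq_pow.mp (hL n))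
  exact { }

theorem prime_case [IsNoetherianRing A] [IsLocalRing A] [IsAdicComplete (maximalIdeal A) A]
    (P : Ideal A) [P.IsPrime] (n : ℕ) :
    ∃ (I : Ideal A) (s : A), Good I s ∧ P ≤ I ∧ I ≤ P ⊔ maximalIdeal A ^ n := by
  have hl : IsLocalRing (A ⧸ P) :=
    IsLocalRing.of_surjective' (Ideal.Quotient.mk P) Ideal.Quotient.mk_surjective
  have := complete_quot P
  obtain ⟨I, s, hI, hIn⟩ := domain_case (A := A ⧸ P) n
  obtain ⟨s, rfl⟩ := Ideal.Quotient.mk_surjective s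
  have hPI : P ≤ I.comap (Ideal.Quotient.mk P) := by
    intro x hx
    rw [Ideal.mem_comap, Ideal.Quotient.eq_zero_iff_mem.mpr hx]
    exact zero_mem _
  refine ⟨I.comap (Ideal.Quotient.mk P), s, ⟨hI.1, fun J hIJ hsJ => ?_⟩, hPI, ?_⟩
  · have hPJ := hPI.trans hIJ
    have hJ : (J.map (Ideal.Quotient.mk P)).comap (Ideal.Quotient.mk P) = J := by
      rw [Ideal.comap_map_of_surjective _ Ideal.Quotient.mk_surjective, ← RingHom.ker_eq_comap_bot,
        Ideal.mk_ker, sup_eq_left.mpr hPJ]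
    rw [← hJ]
    congr 1
    refine hI.2 _ ?_ ?_
    · rw [← Ideal.map_comap_of_surjective _ Ideal.Quotient.mk_surjective I]
      exact Ideal.map_mono hIJ
    · intro h
      apply hsJ
      rw [← hJ]
      exact h
  · intro x hx
    have h1 := hIn hx
    rw [← map_maximalIdeal_quot, ← Ideal.map_pow] at h1
    have h2 : x ∈ ((maximalIdeal A ^ n).map (Ideal.Quotient.mk P)).comap (Ideal.Quotient.mk P) := h1
    rw [Ideal.comap_map_of_surjective _ Ideal.Quotient.mk_surjective, ← RingHom.ker_eq_comap_bot,
        Ideal.mk_ker, sup_comm] at h2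
    exact h2

theorem approx_step [IsNoetherianRing A] [IsLocalRing A] [IsAdicComplete (maximalIdeal A) A]
    (Q P : Ideal A) (f g : A) (hsyz : ∀ a b, a * f + b * g ∈ Q ⊓ P → a ∈ Q ∧ b ∈ P)
    (hQ : ∀ n, ∃ (I : Ideal A) (s : A), Good I s ∧ Q ≤ I ∧ I ≤ Q ⊔ maximalIdeal A ^ n)
    (hP : ∀ n, ∃ (I : Ideal A) (s : A), Good I s ∧ P ≤ I ∧ I ≤ P ⊔ maximalIdeal A ^ n) (n : ℕ) :
    ∃ (I : Ideal A) (s : A), Good I s ∧ Q ⊓ P ≤ I ∧ I ≤ (Q ⊓ P) ⊔ maximalIdeal A ^ n := by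
  obtain ⟨k, hk⟩ := chevalley
    (fun N => (Q ⊔ maximalIdeal A ^ N) ⊓ (P ⊔ maximalIdeal A ^ N)) (by
      intro i j hij
      exact inf_le_inf (sup_le_sup_left (Ideal.pow_le_pow_right hij) _)
        (sup_le_sup_left (Ideal.pow_le_pow_right hij) _)) n
  obtain ⟨I₁, s₁, h₁, hQ1, h1⟩ := hQ k
  obtain ⟨I₂, s₂, h₂, hP2, h2⟩ := hP k
  obtain ⟨I, s, hI, hPI, hI1, hI2⟩ := glue (P := Q ⊓ P) h₁ h₂ f g
    (fun a b h => ⟨hQ1 (hsyz a b h).1, hP2 (hsyz a b h).2⟩)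
  refine ⟨I, s, hI, hPI, (le_inf (hI1.trans h1) (hI2.trans h2)).trans (hk.trans ?_)⟩
  refine sup_le_sup_right ?_ _
  intro z hz
  rw [Submodule.mem_iInf] at hz
  exact ⟨iInf_sup_pow _ fun n => (hz n).1, iInf_sup_pow _ fun n => (hz n).2⟩

theorem approx_finset [IsNoetherianRing A] [IsLocalRing A] [IsAdicComplete (maximalIdeal A) A]
    (S : Finset (Ideal A)) (hS : ∀ P ∈ S, P ∈ minimalPrimes A) (hne : S.Nonempty) :
    ∀ n, ∃ (I : Ideal A) (s : A), Good I s ∧ S.inf id ≤ I ∧ I ≤ S.inf id ⊔ maximalIdeal A ^ n := by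
  classical
  induction hne using Finset.Nonempty.cons_induction with
  | singleton P =>
    have : P.IsPrime := (hS P (by simp)).1.1
    simpa using prime_case P
  | cons P S hPS hne ih =>
    have hPm := hS P (by simp)
    have hPp : P.IsPrime := hPm.1.1
    have hSm : ∀ P ∈ S, P ∈ minimalPrimes A := fun P hP => hS P (by simp [hP])
    have hf : ∃ f ∈ P, ∀ P' ∈ S, f ∉ P' := by
      by_contra! hcon
      have : (P : Set A) ⊆ ⋃ i ∈ (S : Set (Ideal A)), (i : Set A) := by
        intro x hx
        obtain ⟨P', hP', hx'⟩ := hcon x hx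
        simp only [Set.mem_iUnion]
        exact ⟨P', hP', hx'⟩
      obtain ⟨P', hP', hle⟩ := (Ideal.subset_union_prime (f := id) ⊥ ⊥
        (fun i hi _ _ => (hSm i hi).1.1)).mp this
      have : P = P' := le_antisymm hle ((hSm P' hP').2 hPm.1 hle)
      exact hPS (this ▸ hP')
    obtain ⟨f, hfP, hfS⟩ := hf
    have hg : ¬ (S.inf id ≤ P) := by
      intro h
      obtain ⟨P', hP', hle⟩ := (Ideal.IsPrime.inf_le' hPp).mp h
      have : P = P' := le_antisymm (hPm.2 (hSm P' hP').1 hle) hle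
      exact hPS (this ▸ hP')
    obtain ⟨g, hgS, hgP⟩ := Set.not_subset.mp hg
    have := approx_step (S.inf id) P f g (by
      rintro a b ⟨h1, h2⟩
      have ha : a * f ∈ S.inf id := by
        have := sub_mem h1 (Ideal.mul_mem_left _ b hgS)
        simpa using this
      have hb : b * g ∈ P := by
        have := sub_mem h2 (Ideal.mul_mem_left _ a hfP)
        simpa using this
      refine ⟨?_, (hPp.mem_or_mem hb).resolve_right hgP⟩
      rw [Submodule.mem_finsetInf] at ha ⊢
      intro P' hP'
      exact ((hSm P' hP').1.1.mem_or_mem (ha P' hP')).resolve_right (hfS P' hP'))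
      (ih hSm) (prime_case P)
    simpa [Finset.inf_cons, inf_comm] using this

theorem approx_gorenstein [IsNoetherianRing A] [IsLocalRing A] [IsReduced A]
    [IsAdicComplete (maximalIdeal A) A] (n : ℕ) :
    ∃ (I : Ideal A) (s : A), Good I s ∧ I ≤ maximalIdeal A ^ n := by
  have hfin := minimalPrimes.finite_of_isNoetherianRing A
  have hne : hfin.toFinset.Nonempty := by
    obtain ⟨P, hP, -⟩ := Ideal.exists_minimalPrimes_le (bot_le : (⊥ : Ideal A) ≤ maximalIdeal A)
    exact ⟨P, by simpa using hP⟩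
  obtain ⟨I, s, hI, -, h⟩ := approx_finset hfin.toFinset (by simp) hne n
  refine ⟨I, s, hI, h.trans ?_⟩
  have : hfin.toFinset.inf id = ⊥ := by
    rw [eq_bot_iff, ← (nilradical_eq_bot_iff.mpr ‹IsReduced A›), nilradical,
      ← Ideal.sInf_minimalPrimes]
    refine le_sInf fun P hP => Finset.inf_le (f := id) (by simpa using hP)
  rw [this, bot_sup_eq]

end Reduced
section Double
variable {A : Type*} [CommRing A]

theorem ell_le_succ [IsLocalRing A] {C C' : Ideal A} (hCC : C ≤ C') (w : A)
    (hC' : C' ≤ C ⊔ Ideal.span {w}) (hw : ∀ y ∈ maximalIdeal A, y * w ∈ C) :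
    ell C ≤ ell C' + 1 := by
  let φ : (A ⧸ maximalIdeal A) →ₗ[A] (A ⧸ C) :=
    Submodule.mapQ (maximalIdeal A) C (LinearMap.mulRight A w) (by
      intro x hx
      exact hw x hx)
  have h1 : ell C = Module.length A (LinearMap.ker (Submodule.factor hCC)) + ell C' :=
    Module.length_eq_add_of_exact (LinearMap.ker (Submodule.factor hCC)).subtype
      (Submodule.factor hCC) (Submodule.subtype_injective _) (Submodule.factor_surjective hCC)
      (LinearMap.exact_subtype_ker_map _)
  have h2 : LinearMap.ker (Submodule.factor hCC) ≤ LinearMap.range φ := by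
    intro z hz
    obtain ⟨z, rfl⟩ := Submodule.mkQ_surjective _ z
    have hz' : z ∈ C' := by
      have h0 : Submodule.factor hCC (Submodule.mkQ C z) = 0 := hz
      exact (Submodule.Quotient.mk_eq_zero C').mp h0
    obtain ⟨i, hi, v, hv, rfl⟩ := Submodule.mem_sup.mp (hC' hz')
    obtain ⟨y, rfl⟩ := Ideal.mem_span_singleton'.mp hv
    refine ⟨Submodule.mkQ _ y, ?_⟩
    have h0 : φ (Submodule.mkQ _ y) = Submodule.mkQ C (y * w) := rfl
    rw [h0, eq_comm, ← sub_eq_zero, ← map_sub]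
    apply (Submodule.Quotient.mk_eq_zero C).mpr
    simpa using hi
  have h3 : Module.length A (LinearMap.ker (Submodule.factor hCC)) ≤ 1 := by
    have : IsSimpleModule A (A ⧸ maximalIdeal A) :=
      isSimpleModule_iff_isCoatom.mpr (maximalIdeal.isMaximal A).out
    rw [← Module.length_eq_one A (A ⧸ maximalIdeal A)]
    exact (Module.length_le_of_injective (Submodule.inclusion h2)
      (Submodule.inclusion_injective h2)).trans
      (Module.length_le_of_surjective φ.rangeRestrict φ.surjective_rangeRestrict)
  rw [h1, add_comm]
  gcongr

theorem Good.socle [IsLocalRing A] {I : Ideal A} {s : A} (h : Good I s) {u : A}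
    (hu : ∀ y ∈ maximalIdeal A, y * u ∈ I) : ∃ c, u - c * s ∈ I := by
  by_cases huI : u ∈ I
  · exact ⟨0, by simpa using huI⟩
  obtain ⟨y, hy⟩ := h.exists_mul huI
  have hyu : IsUnit y := by
    by_contra hn
    apply h.1
    have := add_mem hy (hu y ((mem_maximalIdeal y).mpr hn))
    simpa using this
  obtain ⟨c, hc⟩ := hyu.exists_left_inv
  refine ⟨c, ?_⟩
  have := neg_mem (Ideal.mul_mem_left I c hy)
  have e : u - c * s = -(c * (s - y * u)) := by linear_combination (-u) * hc
  rw [e]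
  exact this

theorem exists_socle [IsLocalRing A] {C B : Ideal A} (N : ℕ) (hN : maximalIdeal A ^ N ≤ C)
    (hBC : ¬ B ≤ C) : ∃ z ∈ B, z ∉ C ∧ ∀ y ∈ maximalIdeal A, y * z ∈ C := by
  classical
  obtain ⟨x, hxB, hxC⟩ := Set.not_subset.mp hBC
  have hex : ∃ k, maximalIdeal A ^ k * Ideal.span {x} ≤ C := ⟨N, Ideal.mul_le_left.trans hN⟩
  obtain ⟨k, hk⟩ : ∃ k, Nat.find hex = k := ⟨_, rfl⟩
  have hsp := Nat.find_spec hex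
  rw [hk] at hsp
  cases k with
  | zero =>
    refine absurd (hsp ?_) hxC
    rw [pow_zero, Ideal.one_eq_top, Ideal.top_mul]
    exact Ideal.mem_span_singleton_self x
  | succ k =>
    have hk' := Nat.find_min hex (m := k) (by omega)
    obtain ⟨z, hz, hzC⟩ := Set.not_subset.mp hk'
    refine ⟨z, ?_, hzC, fun y hy => hsp ?_⟩
    · exact ((Ideal.span_singleton_le_iff_mem B).mpr hxB) (Ideal.mul_le_right hz)
    · rw [pow_succ', mul_assoc]
      exact Ideal.mul_mem_mul hy hz

theorem colon_length [IsNoetherianRing A] [IsLocalRing A] {I : Ideal A} {s : A} (h : Good I s)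
    (B : Ideal A) (C : Ideal A) (hIC : I ≤ C) (hCB : C ≤ B) :
    ell (I.colon (B : Set A)) + ell B ≤ ell (I.colon (C : Set A)) + ell C := by
  obtain ⟨N, hN⟩ := h.pow_le
  induction C using WellFoundedGT.induction with
  | ind C ih =>
  by_cases hBC : B ≤ C
  · rw [le_antisymm hBC hCB]
  obtain ⟨z, hzB, hzC, hz⟩ := exists_socle N (hN.trans hIC) hBC
  have hlt : C < C ⊔ Ideal.span {z} := by
    refine lt_of_le_of_ne le_sup_left fun he => hzC ?_
    rw [he]
    exact Ideal.mem_sup_right (Ideal.mem_span_singleton_self z)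
  refine (ih _ hlt (hIC.trans le_sup_left)
    (sup_le hCB ((Ideal.span_singleton_le_iff_mem B).mpr hzB))).trans ?_
  have h1 := ell_strict hlt
  have hmem : ∀ y, y ∈ I.colon (C : Set A) → y * z ∈ I →
      y ∈ I.colon ((C ⊔ Ideal.span {z} : Ideal A) : Set A) := by
    intro y hy hyz
    rw [Submodule.mem_colon] at hy ⊢
    intro v hv
    obtain ⟨c, hc, w, hw, rfl⟩ := Submodule.mem_sup.mp hv
    obtain ⟨x, rfl⟩ := Ideal.mem_span_singleton'.mp hw
    have : y • (c + x * z) = y • c + x * (y * z) := by simp only [smul_eq_mul]; ring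
    rw [this]
    exact add_mem (hy c hc) (Ideal.mul_mem_left _ _ hyz)
  have hsoc : ∀ y, y ∈ I.colon (C : Set A) → ∀ x ∈ maximalIdeal A, x * (y * z) ∈ I := by
    intro y hy x hx
    have := Submodule.mem_colon.mp hy _ (hz x hx)
    rw [smul_eq_mul] at this
    rwa [mul_left_comm]
  have hle : I.colon ((C ⊔ Ideal.span {z} : Ideal A) : Set A) ≤ I.colon (C : Set A) :=
    Submodule.colon_mono le_rfl (fun x hx => Ideal.mem_sup_left hx)
  have h2 : ell (I.colon ((C ⊔ Ideal.span {z} : Ideal A) : Set A)) ≤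
      ell (I.colon (C : Set A)) + 1 := by
    by_cases hall : ∀ y ∈ I.colon (C : Set A), y * z ∈ I
    · have : I.colon (C : Set A) = I.colon ((C ⊔ Ideal.span {z} : Ideal A) : Set A) :=
        le_antisymm (fun y hy => hmem y hy (hall y hy)) hle
      rw [← this]
      exact le_self_add
    · push Not at hall
      obtain ⟨w, hw, hwz⟩ := hall
      refine ell_le_succ hle w ?_ ?_
      · intro y hy
        obtain ⟨c, hc⟩ := h.socle (hsoc y hy)
        obtain ⟨d, hd⟩ := h.exists_mul hwz
        have h3 : y - c * d * w ∈ I.colon ((C ⊔ Ideal.span {z} : Ideal A) : Set A) := by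
          refine hmem _ (sub_mem hy (Ideal.mul_mem_left _ _ hw)) ?_
          have := add_mem hc (Ideal.mul_mem_left _ c hd)
          have e : (y - c * d * w) * z = y * z - c * s + c * (s - d * (w * z)) := by ring
          rw [e]
          exact this
        have e : y = (y - c * d * w) + c * d * w := by ring
        rw [e]
        exact Submodule.add_mem_sup h3
          (Ideal.mul_mem_left _ _ (Ideal.mem_span_singleton_self w))
      · intro y hy
        refine hmem _ (Ideal.mul_mem_left _ _ hw) ?_
        rw [mul_assoc]
        exact hsoc w hw y hy
  calc _ ≤ ell (I.colon (C : Set A)) + 1 + ell (C ⊔ Ideal.span {z}) := by gcongr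
    _ = ell (I.colon (C : Set A)) + (ell (C ⊔ Ideal.span {z}) + 1) := by
      rw [add_assoc, add_comm 1]
    _ ≤ _ := by gcongr

theorem ell_top : ell (⊤ : Ideal A) = 0 := by
  have : Subsingleton (A ⧸ (⊤ : Ideal A)) := Ideal.Quotient.subsingleton_iff.mpr rfl
  exact Module.length_eq_zero

theorem colon_length_eq [IsNoetherianRing A] [IsLocalRing A] {I : Ideal A} {s : A} (h : Good I s)
    (B : Ideal A) (hIB : I ≤ B) : ell (I.colon (B : Set A)) + ell B = ell I := by
  apply le_antisymm
  · have := colon_length h B I le_rfl hIB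
    rwa [(Submodule.colon_eq_top_iff_subset (N := I) (I : Set A)).mpr (fun x hx => hx), ell_top,
      zero_add] at this
  · have := colon_length h ⊤ B hIB le_top
    rwa [Submodule.top_coe, Submodule.colon_univ, ell_top, add_zero] at this

theorem double_colon [IsNoetherianRing A] [IsLocalRing A] {I : Ideal A} {s : A} (h : Good I s)
    (B : Ideal A) (hIB : I ≤ B) : I.colon ((I.colon (B : Set A) : Ideal A) : Set A) = B := by
  have h1 := colon_length_eq h B hIB
  have h2 := colon_length_eq h (I.colon (B : Set A)) Ideal.le_colon
  obtain ⟨N, hN⟩ := h.pow_le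
  have := artinian_quot_pow I N hN
  have hfin : ell I ≠ ⊤ := Module.length_ne_top
  have hle : B ≤ I.colon ((I.colon (B : Set A) : Ideal A) : Set A) := by
    intro x hx
    rw [Submodule.mem_colon]
    intro y hy
    have := Submodule.mem_colon.mp hy x hx
    rw [smul_eq_mul] at this ⊢
    rwa [mul_comm]
  by_contra hne
  have h3 := ell_strict (lt_of_le_of_ne hle (Ne.symm hne))
  have f1 : ell (I.colon (B : Set A)) ≠ ⊤ := fun he => hfin (by rw [← h1, he, top_add])
  have f2 : ell B ≠ ⊤ := fun he => hfin (by rw [← h1, he, add_top])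
  have f3 : ell (I.colon ((I.colon (B : Set A) : Ideal A) : Set A)) ≠ ⊤ :=
    fun he => hfin (by rw [← h2, he, top_add])
  generalize ell (I.colon ((I.colon (B : Set A) : Ideal A) : Set A)) = a3 at *
  generalize ell (I.colon (B : Set A)) = a1 at *
  generalize ell B = a2 at *
  lift a1 to ℕ using f1
  lift a2 to ℕ using f2
  lift a3 to ℕ using f3
  rw [← h1] at h2
  norm_cast at h2 h3
  omega

end Double
section Abstract
variable {A : Type*} [CommRing A]

theorem abstract_skoda [IsNoetherianRing A] [IsLocalRing A] [IsReduced A]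
    [IsAdicComplete (maximalIdeal A) A] (S T : Ideal A → Ideal A) (a : Ideal A)
    (hS : ∀ J, J ≤ S J)
    (hmul : ∀ (J I : Ideal A) (u : A), (∀ j ∈ J, u * j ∈ I) → ∀ z ∈ S J, u * z ∈ S I)
    (hT : ∀ J z, z ∈ T J ↔ ∀ x ∈ a, x * z ∈ S J) :
    (⨅ J : Ideal A, J.colon (T J : Set A)) = (⨅ J : Ideal A, J.colon (S J : Set A)) * a := by
  have hmono : ∀ {J I : Ideal A}, J ≤ I → S J ≤ S I := by
    intro J I h z hz
    have := hmul J I 1 (fun j hj => by rw [one_mul]; exact h hj) z hz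
    rwa [one_mul] at this
  apply le_antisymm
  · set τ := ⨅ J : Ideal A, J.colon (S J : Set A) with hτ
    intro u hu
    apply iInf_sup_pow
    intro N
    let V : ℕ → Ideal A := fun k => ⨅ (J : Ideal A) (_ : maximalIdeal A ^ k ≤ J), J.colon (S J : Set A)
    have hV : Antitone V := by
      intro i j hij
      refine le_iInf₂ fun J hJ => iInf₂_le J ((Ideal.pow_le_pow_right hij).trans hJ)
    have hVτ : (⨅ k, V k) ≤ τ := by
      intro v hv
      rw [hτ, Submodule.mem_iInf]
      intro J
      rw [Submodule.mem_colon]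
      intro z hz
      apply iInf_sup_pow
      intro n
      have h1 := (Submodule.mem_iInf _).mp hv n
      have h2 : V n ≤ (J ⊔ maximalIdeal A ^ n).colon (S (J ⊔ maximalIdeal A ^ n) : Set A) :=
        iInf₂_le _ le_sup_right
      exact Submodule.mem_colon.mp (h2 h1) z (hmono le_sup_left hz)
    obtain ⟨k, hk⟩ := chevalley V hV N
    obtain ⟨I, s, hI, hIk⟩ := approx_gorenstein (A := A) (max k N)
    have hVI : I.colon (S I : Set A) ≤ V k := by
      refine le_iInf₂ fun J hJ => ?_
      have hIJ : I ≤ J := (hIk.trans (Ideal.pow_le_pow_right (le_max_left _ _))).trans hJ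
      intro v hv
      rw [Submodule.mem_colon]
      intro z hz
      rw [← double_colon hI J hIJ, Submodule.mem_colon]
      intro w hw
      have h1 : w * z ∈ S I := hmul J I w (fun j hj => Submodule.mem_colon.mp hw j hj) z hz
      have h2 := Submodule.mem_colon.mp hv _ h1
      simp only [smul_eq_mul] at h2 ⊢
      rwa [mul_assoc, mul_comm z w]
    have huI : u ∈ I ⊔ I.colon (S I : Set A) * a := by
      rw [← double_colon hI (I ⊔ I.colon (S I : Set A) * a) le_sup_left]
      refine Submodule.colon_mono le_rfl ?_ ((Submodule.mem_iInf _).mp hu I)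
      intro y hy
      refine (hT I y).mpr fun x hx => ?_
      rw [← double_colon hI (S I) (hS I), Submodule.mem_colon]
      intro w hw
      have := Submodule.mem_colon.mp hy (w * x) (Ideal.mem_sup_right (Ideal.mul_mem_mul hw hx))
      simp only [smul_eq_mul] at this ⊢
      have e : x * y * w = y * (w * x) := by ring
      rwa [e]
    have hIN : I ≤ maximalIdeal A ^ N := hIk.trans (Ideal.pow_le_pow_right (le_max_right _ _))
    refine (sup_le (hIN.trans le_sup_right) ?_) huI
    have h3 : I.colon (S I : Set A) ≤ τ ⊔ maximalIdeal A ^ N :=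
      hVI.trans (hk.trans (sup_le_sup_right hVτ _))
    refine (Ideal.mul_mono_left h3).trans ?_
    rw [Ideal.sup_mul]
    exact sup_le_sup_left Ideal.mul_le_left _
  · rw [Ideal.mul_le]
    intro u hu x hx
    rw [Submodule.mem_iInf] at hu ⊢
    intro J
    rw [Submodule.mem_colon]
    intro z hz
    have := Submodule.mem_colon.mp (hu J) _ ((hT J z).mp hz x hx)
    simp only [smul_eq_mul] at this ⊢
    rwa [mul_assoc]

/-- pigeonhole for monomials of degree `l * q` in `l` generators -/
theorem pigeon (l q : ℕ) (hl : 1 ≤ l) (x : Fin l → A) :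
    Ideal.span (Set.range x) ^ (l * q) ≤
      Ideal.span (Set.range fun i => x i ^ q) * Ideal.span (Set.range x) ^ ((l - 1) * q) := by
  classical
  have : Nonempty (Fin l) := ⟨⟨0, hl⟩⟩
  conv_lhs => rw [Ideal.span, Submodule.span_pow]
  rw [Submodule.span_le]
  intro w hw
  obtain ⟨f, rfl⟩ := Set.mem_pow.mp hw
  have hf : ∀ j, ∃ i, x i = f j := fun j => (f j).2
  choose σ hσ using hf
  obtain ⟨i, hi⟩ := Fintype.exists_le_card_fiber_of_mul_le_card σ (n := q) (by simp)
  obtain ⟨T, hT, hTc⟩ := Finset.exists_subset_card_eq hi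
  rw [List.prod_ofFn, ← Finset.prod_mul_prod_compl T]
  apply Ideal.mul_mem_mul
  · have h1 : ∏ j ∈ T, (f j : A) = ∏ j ∈ T, x i := by
      refine Finset.prod_congr rfl fun j hj => ?_
      have := (Finset.mem_filter.mp (hT hj)).2
      rw [← hσ j, this]
    rw [h1, Finset.prod_const, hTc]
    exact Ideal.subset_span ⟨i, rfl⟩
  · have hc : (l - 1) * q = Tᶜ.card := by
      rw [Finset.card_compl, hTc, Fintype.card_fin, Nat.sub_mul, one_mul]
    rw [hc, ← Finset.prod_const]
    exact Ideal.prod_mem_prod fun j _ => Ideal.subset_span (f j).2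

theorem red_pow (a q : Ideal A) (n : ℕ) (h : a ^ (n + 1) = q * a ^ n) (m : ℕ) :
    a ^ n * a ^ m = q ^ m * a ^ n := by
  induction m with
  | zero => simp
  | succ m ih =>
    calc a ^ n * a ^ (m + 1) = (a ^ n * a ^ m) * a := by rw [pow_succ]; ring
      _ = q ^ m * a ^ (n + 1) := by rw [ih, pow_succ]; ring
      _ = _ := by rw [h]; ring

end Abstract

section Concrete
variable {A : Type u} [CommRing A]

theorem Rcirc_one : (1 : A) ∈ Rcirc A := fun P hP h =>
  hP.1.1.ne_top ((Ideal.eq_top_iff_one P).mpr h)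

theorem Rcirc_mul {c d : A} (hc : c ∈ Rcirc A) (hd : d ∈ Rcirc A) : c * d ∈ Rcirc A :=
  fun P hP h => (hP.1.1.mem_or_mem h).elim (hc P hP) (hd P hP)

theorem Rcirc_pow {c : A} (hc : c ∈ Rcirc A) (n : ℕ) : c ^ n ∈ Rcirc A :=
  fun P hP h => hc P hP (hP.1.1.mem_of_pow_mem n h)

theorem Rcirc_prod {ι : Type*} (s : Finset ι) (c : ι → A) (hc : ∀ i, c i ∈ Rcirc A) :
    ∏ i ∈ s, c i ∈ Rcirc A := by
  classical
  induction s using Finset.induction_on with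
  | empty => simpa using Rcirc_one
  | insert i s hi ih => rw [Finset.prod_insert hi]; exact Rcirc_mul (hc i) ih

theorem exists_Rcirc [IsNoetherianRing A] (a : Ideal A)
    (hht : ∀ P ∈ minimalPrimes A, ¬ a ≤ P) : ∃ d ∈ a, d ∈ Rcirc A := by
  by_contra! hcon
  have hfin := minimalPrimes.finite_of_isNoetherianRing A
  have : (a : Set A) ⊆ ⋃ i ∈ (hfin.toFinset : Set (Ideal A)), (i : Set A) := by
    intro x hx
    have := hcon x hx
    change ¬ ∀ P ∈ minimalPrimes A, x ∉ P at this
    push Not at this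
    obtain ⟨P, hP, hxP⟩ := this
    simp only [Set.mem_iUnion]
    exact ⟨P, by simpa using hP, hxP⟩
  obtain ⟨P, hP, hle⟩ := (Ideal.subset_union_prime (f := id) ⊥ ⊥
    (fun i hi _ _ => (hfin.mem_toFinset.mp hi).1.1)).mp this
  exact hht P (hfin.mem_toFinset.mp hP) hle

theorem frob_mul {J I : Ideal A} (u : A) (q : ℕ) (h : ∀ j ∈ J, u * j ∈ I) {w : A}
    (hw : w ∈ frobPow A J q) : u ^ q * w ∈ frobPow A I q := by
  induction hw using Submodule.span_induction with
  | mem x hx =>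
    obtain ⟨j, hj, rfl⟩ := hx
    refine Ideal.subset_span ⟨u * j, h j hj, ?_⟩
    simp [mul_pow]
  | zero => simp
  | add x y _ _ hx hy => rw [mul_add]; exact add_mem hx hy
  | smul r x _ hx =>
    rw [smul_eq_mul, mul_left_comm]
    exact Ideal.mul_mem_left _ _ hx

theorem tc_mul (p : ℕ) (a b : Ideal A) (s : ℕ) (t : ℚ) (J I : Ideal A) (u : A)
    (h : ∀ j ∈ J, u * j ∈ I) (z : A) (hz : z ∈ tightClosure2 A p a b s t J) :
    u * z ∈ tightClosure2 A p a b s t I := by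
  obtain ⟨c, hc, e₀, H⟩ := hz
  refine ⟨c, hc, e₀, fun e he x hx => ?_⟩
  have := frob_mul u (p ^ e) h (H e he x hx)
  have e : c * (u * z) ^ p ^ e * x = u ^ p ^ e * (c * z ^ p ^ e * x) := by rw [mul_pow]; ring
  rwa [e]

/-- the tight closure as an ideal -/
def tcIdeal (p : ℕ) [Fact p.Prime] [CharP A p] (a b : Ideal A) (s : ℕ) (t : ℚ) (J : Ideal A) :
    Ideal A where
  carrier := tightClosure2 A p a b s t J
  zero_mem' := by
    refine ⟨1, Rcirc_one, 0, fun e _ x _ => ?_⟩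
    have : p ^ e ≠ 0 := pow_ne_zero _ (Fact.out : p.Prime).ne_zero
    rw [zero_pow this, mul_zero, zero_mul]
    exact zero_mem _
  add_mem' := by
    rintro z w ⟨c, hc, e₀, H⟩ ⟨d, hd, e₁, K⟩
    refine ⟨c * d, Rcirc_mul hc hd, max e₀ e₁, fun e he x hx => ?_⟩
    have h1 := Ideal.mul_mem_left _ d (H e (le_of_max_le_left he) x hx)
    have h2 := Ideal.mul_mem_left _ c (K e (le_of_max_le_right he) x hx)
    have h3 := add_mem h1 h2
    have e : c * d * (z + w) ^ p ^ e * x =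
        d * (c * z ^ p ^ e * x) + c * (d * w ^ p ^ e * x) := by
      rw [add_pow_char_pow]; ring
    rwa [e]
  smul_mem' := fun u z hz => tc_mul p a b s t J J u (fun j hj => Ideal.mul_mem_left _ _ hj) z hz

theorem le_tcIdeal (p : ℕ) [Fact p.Prime] [CharP A p] (a b : Ideal A) (s : ℕ) (t : ℚ)
    (J : Ideal A) : J ≤ tcIdeal p a b s t J := by
  intro z hz
  refine ⟨1, Rcirc_one, 0, fun e _ x _ => ?_⟩
  rw [one_mul]
  exact Ideal.mul_mem_right _ _ (Ideal.subset_span ⟨z, hz, rfl⟩)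

theorem testIdeal2_eq (p : ℕ) [Fact p.Prime] [CharP A p] (a b : Ideal A) (s : ℕ) (t : ℚ) :
    testIdeal2 A p a b s t = ⨅ J : Ideal A, J.colon (tcIdeal p a b s t J : Set A) := by
  unfold testIdeal2
  refine iInf_congr fun J => ?_
  have : Ideal.span (tightClosure2 A p a b s t J) = tcIdeal p a b s t J :=
    Ideal.span_eq (tcIdeal p a b s t J)
  rw [this]

theorem tc_iff [IsNoetherianRing A] (p : ℕ) [Fact p.Prime] [CharP A p] (a : Ideal A)
    (hht : ∀ P ∈ minimalPrimes A, ¬ a ≤ P) (l : ℕ) (hl : 1 ≤ l) (x : Fin l → A)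
    (hx : Ideal.span (Set.range x) ≤ a) (n : ℕ)
    (hn : a ^ (n + 1) = Ideal.span (Set.range x) * a ^ n) (b : Ideal A) (t : ℚ)
    (J : Ideal A) (z : A) :
    z ∈ tcIdeal p a b l t J ↔ ∀ y ∈ a, y * z ∈ tcIdeal p a b (l - 1) t J := by
  constructor
  · rintro ⟨c, hc, e₀, H⟩ y hy
    refine ⟨c, hc, e₀, fun e he w hw => ?_⟩
    have h1 : y ^ p ^ e * w ∈ a ^ (l * p ^ e) * b ^ ⌈t * (p : ℚ) ^ e⌉₊ := by
      have hle : l * p ^ e = p ^ e + (l - 1) * p ^ e := by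
        obtain ⟨k, rfl⟩ : ∃ k, l = k + 1 := ⟨l - 1, by omega⟩
        simp; ring
      rw [hle, pow_add, mul_assoc]
      exact Ideal.mul_mem_mul (Ideal.pow_mem_pow hy _) hw
    have h2 := H e he _ h1
    have e : c * (y * z) ^ p ^ e * w = c * z ^ p ^ e * (y ^ p ^ e * w) := by rw [mul_pow]; ring
    rwa [e]
  · intro h
    have h' : ∀ i, x i * z ∈ tcIdeal p a b (l - 1) t J :=
      fun i => h _ (hx (Ideal.subset_span ⟨i, rfl⟩))
    choose c hc e₀ H using h'
    obtain ⟨d, hda, hd⟩ := exists_Rcirc a hht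
    refine ⟨d ^ n * ∏ i, c i, Rcirc_mul (Rcirc_pow hd n) (Rcirc_prod _ _ hc),
      Finset.univ.sup e₀, fun e he y hy => ?_⟩
    set q := p ^ e with hq
    set B := b ^ ⌈t * (p : ℚ) ^ e⌉₊ with hB
    have h1 : d ^ n * y ∈ Ideal.span (Set.range fun i => x i ^ q) * (a ^ ((l - 1) * q) * B) := by
      have h2 : d ^ n * y ∈ a ^ n * (a ^ (l * q) * B) :=
        Ideal.mul_mem_mul (Ideal.pow_mem_pow hda n) hy
      rw [← mul_assoc, red_pow a _ n hn, mul_assoc] at h2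
      have h3 := Ideal.mul_mono (pigeon l q hl x) (Ideal.mul_le_right (I := a ^ n) (J := B)) h2
      rw [mul_assoc] at h3
      exact Ideal.mul_mono_right (Ideal.mul_mono_left (Ideal.pow_right_mono hx _)) h3
    have h4 : Ideal.span (Set.range fun i => x i ^ q) * (a ^ ((l - 1) * q) * B) ≤
        (frobPow A J q).colon {(∏ i, c i) * z ^ q} := by
      rw [Ideal.mul_le]
      intro r hr w hw
      rw [Submodule.mem_colon_singleton, smul_eq_mul]
      induction hr using Submodule.span_induction with
      | mem r hr =>
        obtain ⟨i, rfl⟩ := hr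
        have h5 := H i e ((Finset.le_sup (Finset.mem_univ i)).trans he) w hw
        have h6 := Ideal.mul_mem_left _ (∏ j ∈ Finset.univ.erase i, c j) h5
        have e1 : x i ^ q * w * ((∏ i, c i) * z ^ q) =
            (∏ j ∈ Finset.univ.erase i, c j) * (c i * (x i * z) ^ q * w) := by
          rw [← Finset.mul_prod_erase Finset.univ c (Finset.mem_univ i), mul_pow]; ring
        simp only
        rw [e1]
        exact h6
      | zero => simp
      | add r r' _ _ hr hr' => rw [add_mul, add_mul]; exact add_mem hr hr'
      | smul k r _ hr =>
        rw [smul_eq_mul, mul_assoc, mul_assoc]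
        rw [mul_assoc] at hr
        exact Ideal.mul_mem_left _ _ hr
    have h5 := Submodule.mem_colon_singleton.mp (h4 h1)
    rw [smul_eq_mul] at h5
    have e1 : d ^ n * (∏ i, c i) * z ^ q * y = d ^ n * y * ((∏ i, c i) * z ^ q) := by ring
    rw [e1]
    exact h5

end Concrete
end SkodaAux
/-- **Theorem 4.1 (Skoda-type theorem)** (Hara–Takagi).  `(R,m)` a complete Noetherian reduced
local ring of characteristic `p > 0`, `a` an ideal of positive height with a reduction
generated by `l` elements, `b ∩ R° ≠ ∅`, `t ≥ 0` rational.  Then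
`τ(aˡ·bᵗ) = τ(aˡ⁻¹·bᵗ)·a`. -/
theorem skoda_theorem_complete
    (p : ℕ) [Fact p.Prime] [CharP R p]
    [IsNoetherianRing R] [IsReduced R] [IsLocalRing R]
    [IsAdicComplete (IsLocalRing.maximalIdeal R) R]
    (a : Ideal R) (hht : ∀ P ∈ minimalPrimes R, ¬ a ≤ P)
    (l : ℕ)
    (hred : ∃ q : Ideal R, q ≤ a ∧ (∃ x : Fin l → R, Ideal.span (Set.range x) = q) ∧
      ∃ n : ℕ, a ^ (n + 1) = q * a ^ n)
    (b : Ideal R) (hb : ((b : Set R) ∩ Rcirc R).Nonempty)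
    (t : ℚ) (ht : 0 ≤ t) :
    testIdeal2 R p a b l t = testIdeal2 R p a b (l - 1) t * a := by
  obtain ⟨q, hqa, ⟨x, rfl⟩, n, hn⟩ := hred
  have hl : 1 ≤ l := by
    by_contra hl0
    have hl0 : l = 0 := by omega
    subst hl0
    obtain ⟨P, hP, -⟩ := Ideal.exists_minimalPrimes_le
      (bot_le : (⊥ : Ideal R) ≤ IsLocalRing.maximalIdeal R)
    refine hht P hP (hP.1.1.le_of_pow_le (n := n + 1) ?_)
    rw [hn]
    simp
  rw [SkodaAux.testIdeal2_eq, SkodaAux.testIdeal2_eq]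
  exact SkodaAux.abstract_skoda _ _ a (SkodaAux.le_tcIdeal p a b (l - 1) t)
    (SkodaAux.tc_mul p a b (l - 1) t)
    (SkodaAux.tc_iff p a hht l hl x hqa n hn b t)
end

section
/- Let R be a Noetherian reduced commutative ring of prime characteristic p > 0, let a ⊆ R be an ideal generated by l elements with a ∩ R° ≠ ∅, let b be an ideal of R with b ∩ R° ≠ ∅, and let t ≥ 0 be a rational number. Then for every R-module M, 0^{*a^l b^t}_M = (0^{*a^{l-1} b^t}_M :_M a), i.e., an element z ∈ M lies in the a^l·b^t-tight closure of 0 in M if and only if z·a ⊆ 0^{*a^{l-1} b^t}_M. -/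
open scoped TensorProduct

universe u

variable (R : Type u) [CommRing R]

/-- `0^{*aˢbᵗ}_M`, the `aˢ·bᵗ`-tight closure of zero in a module `M`. -/
def moduleTC2 (p : ℕ) [ExpChar R p] (a b : Ideal R) (s : ℕ) (t : ℚ)
    (M : Type u) [AddCommGroup M] [Module R M] : Set M :=
  {z : M | ∃ c ∈ Rcirc R, ∃ e₀ : ℕ, ∀ e : ℕ, e₀ ≤ e →
    ∀ x ∈ a ^ (s * p ^ e) * b ^ ⌈t * (p : ℚ) ^ e⌉₊,
      (FrobAlg.of R p e (c * x)) ⊗ₜ[R] z = (0 : TensorProduct R (FrobAlg R p e) M)}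

/-- If `a` has `l ≥ 1` generators then `a^{lq} ⊆ a^{[q]} a^{(l-1)q}`. -/
theorem pow_gens_le {R : Type u} [CommRing R] (l q : ℕ) (hl : 0 < l) (x : Fin l → R)
    (a : Ideal R) (hxa : Ideal.span (Set.range x) = a) :
    a ^ (l * q) ≤ Ideal.span (Set.range fun i => x i ^ q) * a ^ ((l - 1) * q) := by
  conv_lhs => rw [← hxa, Ideal.span, Submodule.span_pow]
  rw [Submodule.span_le]
  intro r hr
  rw [SetLike.mem_coe]
  rw [Set.mem_pow] at hr
  obtain ⟨f, rfl⟩ := hr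
  rw [List.prod_ofFn]
  choose g hg using fun j => (f j).2
  have hne : Nonempty (Fin l) := ⟨⟨0, hl⟩⟩
  obtain ⟨i, -, hi⟩ := Finset.exists_le_card_fiber_of_mul_le_card_of_maps_to
    (s := (Finset.univ : Finset (Fin (l * q)))) (t := (Finset.univ : Finset (Fin l))) (f := g)
    (n := q) (fun _ _ => Finset.mem_univ _) Finset.univ_nonempty (by simp)
  obtain ⟨T, hT, hTc⟩ := Finset.exists_subset_card_eq hi
  rw [← Finset.prod_mul_prod_compl T]
  apply Ideal.mul_mem_mul
  · have : ∏ j ∈ T, ((f j : R)) = x i ^ q := by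
      refine (Finset.prod_congr rfl fun j hj => ?_).trans
        ((Finset.prod_const (x i)).trans (congrArg (fun n => x i ^ n) hTc))
      have := hT hj
      simp only [Finset.mem_filter] at this
      rw [← hg j, this.2]
    rw [this]
    exact Ideal.subset_span ⟨i, rfl⟩
  · have hc : (l - 1) * q = Tᶜ.card := by
      rw [Finset.card_compl, hTc, Fintype.card_fin, Nat.sub_mul, one_mul]
    rw [hc, ← Finset.prod_const]
    refine Ideal.prod_mem_prod fun j _ => ?_
    rw [← hxa, ← hg j]
    exact Ideal.subset_span ⟨_, rfl⟩

/-- The annihilator of `z^q`. -/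
def annFrob (R : Type u) [CommRing R] (p : ℕ) [ExpChar R p] (e : ℕ)
    (M : Type u) [AddCommGroup M] [Module R M] (z : M) : Ideal R where
  carrier := {r | (FrobAlg.of R p e r) ⊗ₜ[R] z = (0 : TensorProduct R (FrobAlg R p e) M)}
  add_mem' := by
    intro r s hr hs
    simp only [Set.mem_ofPred_eq] at *
    rw [map_add, TensorProduct.add_tmul, hr, hs, add_zero]
  zero_mem' := by simp
  smul_mem' := by
    intro r s hs
    simp only [Set.mem_ofPred_eq] at *
    rw [smul_eq_mul, map_mul, ← smul_eq_mul, ← TensorProduct.smul_tmul', hs, smul_zero]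

theorem mem_annFrob {R : Type u} [CommRing R] {p : ℕ} [ExpChar R p] {e : ℕ}
    {M : Type u} [AddCommGroup M] [Module R M] {z : M} {r : R} :
    r ∈ annFrob R p e M z ↔
      (FrobAlg.of R p e r) ⊗ₜ[R] z = (0 : TensorProduct R (FrobAlg R p e) M) := Iff.rfl

theorem mem_annFrob_smul {R : Type u} [CommRing R] {p : ℕ} [ExpChar R p] {e : ℕ}
    {M : Type u} [AddCommGroup M] [Module R M] {z : M} {r y : R} :
    r ∈ annFrob R p e M (y • z) ↔ r * y ^ p ^ e ∈ annFrob R p e M z := by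
  rw [mem_annFrob, mem_annFrob, TensorProduct.tmul_smul, TensorProduct.smul_tmul',
    Algebra.smul_def, map_mul, mul_comm]
  rfl

theorem Rcirc_prod {R : Type u} [CommRing R] {l : ℕ} (c : Fin l → R)
    (hc : ∀ i, c i ∈ Rcirc R) : ∏ i, c i ∈ Rcirc R := by
  intro P hP h
  have : P.IsPrime := hP.1.1
  rw [Ideal.IsPrime.prod_mem_iff] at h
  obtain ⟨i, -, hi⟩ := h
  exact hc i P hP hi

/-- (Hara–Takagi, proof of Theorem 4.1): if `a` is generated by `l` elements, then for every
`R`-module `M`, `0^{*aˡbᵗ}_M = (0^{*aˡ⁻¹bᵗ}_M :_M a)`. -/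
theorem moduleTC_pow_eq_colon
    (p : ℕ) [Fact p.Prime] [CharP R p] [ExpChar R p]
    [IsNoetherianRing R] [IsReduced R]
    (l : ℕ) (a : Ideal R) (x : Fin l → R) (hxa : Ideal.span (Set.range x) = a)
    (ha : ((a : Set R) ∩ Rcirc R).Nonempty)
    (b : Ideal R) (hb : ((b : Set R) ∩ Rcirc R).Nonempty)
    (t : ℚ) (ht : 0 ≤ t)
    (M : Type u) [AddCommGroup M] [Module R M] (z : M) :
    z ∈ moduleTC2 R p a b l t M ↔ ∀ y ∈ a, y • z ∈ moduleTC2 R p a b (l - 1) t M := by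
  rcases Nat.eq_zero_or_pos l with rfl | hl
  · obtain ⟨w, hw, hwc⟩ := ha
    have h0 : a = ⊥ := by rw [← hxa]; simp
    rw [h0] at hw
    have hw0 : w = 0 := by simpa using hw
    have hs : Subsingleton R := by
      by_contra hns
      rw [not_subsingleton_iff_nontrivial] at hns
      obtain ⟨P, hP⟩ := Ideal.nonempty_minimalPrimes (I := (⊥ : Ideal R)) bot_ne_top
      exact hwc P hP (hw0 ▸ P.zero_mem)
    have key : ∀ z : M, ∀ s, z ∈ moduleTC2 R p a b s t M := fun z s =>
      ⟨w, hwc, 0, fun e _ r _ => by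
        rw [Subsingleton.elim (w * r) 0, map_zero, TensorProduct.zero_tmul]⟩
    exact ⟨fun _ y _ => key _ _, fun _ => key _ _⟩
  constructor
  · rintro ⟨c, hc, e₀, h⟩ y hy
    refine ⟨c, hc, e₀, fun e he r hr => ?_⟩
    rw [← mem_annFrob, mem_annFrob_smul, mul_assoc]
    apply h e he
    have hl' : l * p ^ e = (l - 1) * p ^ e + p ^ e := by
      obtain ⟨k, rfl⟩ := Nat.exists_eq_add_of_lt hl
      simp; ring
    rw [hl', pow_add, mul_right_comm]
    exact Ideal.mul_mem_mul hr (Ideal.pow_mem_pow hy _)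
  · intro h
    have hx : ∀ i, x i ∈ a := fun i => hxa ▸ Ideal.subset_span ⟨i, rfl⟩
    choose c hc e₀ H using fun i => h (x i) (hx i)
    refine ⟨∏ i, c i, Rcirc_prod c hc, ∑ i, e₀ i, fun e he r hr => ?_⟩
    rw [← mem_annFrob]
    have hle : a ^ (l * p ^ e) * b ^ ⌈t * (p : ℚ) ^ e⌉₊ ≤
        Ideal.span (Set.range fun i => x i ^ p ^ e) *
          (a ^ ((l - 1) * p ^ e) * b ^ ⌈t * (p : ℚ) ^ e⌉₊) := by
      rw [← mul_assoc]
      exact Ideal.mul_mono_left (pow_gens_le l _ hl x a hxa)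
    have hr' := hle hr
    have hle2 : Ideal.span (Set.range fun i => x i ^ p ^ e) *
          (a ^ ((l - 1) * p ^ e) * b ^ ⌈t * (p : ℚ) ^ e⌉₊) ≤
        Submodule.comap (LinearMap.mulLeft R (∏ i, c i)) (annFrob R p e M z) := by
      conv_lhs => rw [← Ideal.span_eq (a ^ ((l - 1) * p ^ e) * b ^ ⌈t * (p : ℚ) ^ e⌉₊)]
      rw [Ideal.span_mul_span', Ideal.span_le]
      rintro _ ⟨_, ⟨i, rfl⟩, s, hs, rfl⟩
      have h1 := H i e ((Finset.single_le_sum (f := e₀) (fun _ _ => Nat.zero_le _)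
        (Finset.mem_univ i)).trans he) s hs
      rw [← mem_annFrob, mem_annFrob_smul] at h1
      obtain ⟨d, hd⟩ := Finset.dvd_prod_of_mem c (Finset.mem_univ i)
      change (∏ i, c i) * (x i ^ p ^ e * s) ∈ annFrob R p e M z
      rw [hd]
      have := (annFrob R p e M z).mul_mem_left d h1
      convert this using 1
      ring
    exact hle2 hr'
end
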